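/- arXiv:1408.5266 — 2 statements merged into one kernel-verified Lean document; each statement's English description precedes it below -/
import Mathlib

section
/- The Volterra integral equation of the second kind φ(t,s,i,y) = ((1−F(T−t+y|i))/(1−F(y|i))) η_i(t,s) + ∫₀^{T−t} e^{−r(i)v} (f(y+v|i)/(1−F(y|i))) Σ_j p_{ij} ∫₀^∞ φ(t+v,x,j,0) α(x;s,i,v) dx dv, with boundary condition φ(t,0,i,y) = 0 for all t ∈ [0,T], i, and y ∈ [0,t], has exactly one solution φ that is continuous on the closure of D and has at most linear growth in s; moreover this solution is non-negative. -/
open MeasureTheory Real Set Finset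

/-- Standard normal cumulative distribution function. -/
noncomputable def stdNormalCDF (x : ℝ) : ℝ :=
  ∫ u in Set.Iic x, Real.exp (-u ^ 2 / 2) / Real.sqrt (2 * Real.pi)

/-- Black–Scholes price of a European call with rate `r`, volatility `σ`,
strike `K`, maturity `T`, evaluated at time `t` and stock price `s`;
with `η(t,0)=0` and `η(T,s)=(s-K)⁺`. -/
noncomputable def bsPrice (r σ K T t s : ℝ) : ℝ :=
  if s ≤ 0 then 0
  else if t < T then
    s * stdNormalCDF ((Real.log (s / K) + (r + σ ^ 2 / 2) * (T - t)) / (σ * Real.sqrt (T - t)))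
      - K * Real.exp (-r * (T - t)) *
        stdNormalCDF ((Real.log (s / K) + (r + σ ^ 2 / 2) * (T - t)) / (σ * Real.sqrt (T - t))
          - σ * Real.sqrt (T - t))
  else max (s - K) 0

/-- `L(x,s,i,v)` of the lognormal kernel. -/
noncomputable def lnL (r σ x s v : ℝ) : ℝ :=
  (Real.log (x / s) - (r - σ ^ 2 / 2) * v) / (σ * Real.sqrt v)

/-- The lognormal kernel `α(x; s, i, v)`. -/
noncomputable def lnKernel (r σ x s v : ℝ) : ℝ :=
  Real.exp (-(lnL r σ x s v) ^ 2 / 2) / (Real.sqrt (2 * Real.pi) * x * σ * Real.sqrt v)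

/-- The domain `D` (in the variables `(t, s, y)`, the regime being kept separate). -/
def domD (T : ℝ) : Set (ℝ × ℝ × ℝ) :=
  {q | 0 < q.1 ∧ q.1 < T ∧ 0 < q.2.1 ∧ 0 < q.2.2 ∧ q.2.2 < q.1}

/-- The closure of the domain `D`. -/
def domDbar (T : ℝ) : Set (ℝ × ℝ × ℝ) :=
  {q | 0 ≤ q.1 ∧ q.1 ≤ T ∧ 0 ≤ q.2.1 ∧ 0 ≤ q.2.2 ∧ q.2.2 ≤ q.1}

/-- The right hand side of the Volterra integral equation. -/
noncomputable def ieRHS {k : ℕ} (r σ : Fin k → ℝ) (p : Fin k → Fin k → ℝ)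
    (f F : Fin k → ℝ → ℝ) (K T : ℝ) (φ : ℝ → ℝ → Fin k → ℝ → ℝ)
    (t s : ℝ) (i : Fin k) (y : ℝ) : ℝ :=
  (1 - F i (T - t + y)) / (1 - F i y) * bsPrice (r i) (σ i) K T t s
    + ∫ v in Set.Ioo (0 : ℝ) (T - t),
        Real.exp (-(r i) * v) * (f i (y + v) / (1 - F i y)) *
          ∑ j, p i j * ∫ x in Set.Ioi (0 : ℝ), φ (t + v) x j 0 * lnKernel (r i) (σ i) x s v

/-- Continuity on the closure of `D`. -/
def ContOnClosure (T : ℝ) {k : ℕ} (φ : ℝ → ℝ → Fin k → ℝ → ℝ) : Prop :=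
  ∀ i, ContinuousOn (fun q : ℝ × ℝ × ℝ => φ q.1 q.2.1 i q.2.2) (domDbar T)

/-- At most linear growth in the stock variable: `sup_D |φ|/(1+s) < ∞`. -/
def LinGrowth (T : ℝ) {k : ℕ} (φ : ℝ → ℝ → Fin k → ℝ → ℝ) : Prop :=
  ∃ C : ℝ, ∀ t s y : ℝ, (t, s, y) ∈ domD T → ∀ i, |φ t s i y| ≤ C * (1 + s)

/-- `φ` solves the Volterra integral equation together with boundary condition
`φ(t,0,i,y) = 0`. -/
def SolvesIE {k : ℕ} (r σ : Fin k → ℝ) (p : Fin k → Fin k → ℝ)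
    (f F : Fin k → ℝ → ℝ) (K T : ℝ) (φ : ℝ → ℝ → Fin k → ℝ → ℝ) : Prop :=
  (∀ t s y : ℝ, (t, s, y) ∈ domD T → ∀ i,
      φ t s i y = ieRHS r σ p f F K T φ t s i y) ∧
  (∀ t y : ℝ, ∀ i, 0 ≤ t → t ≤ T → 0 ≤ y → y ≤ t → φ t 0 i y = 0)


section Helpers
open ProbabilityTheory Filter Topology

/-- Expectation of `h` of a geometric Brownian motion. -/
noncomputable def gEx (r σ : ℝ) (h : ℝ → ℝ) (s v : ℝ) : ℝ :=
  ∫ z, h (s * Real.exp ((r - σ ^ 2 / 2) * v + σ * Real.sqrt v * z)) ∂(gaussianReal 0 1)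

lemma pdf01 (z : ℝ) : gaussianPDFReal 0 1 z = Real.exp (-z ^ 2 / 2) / Real.sqrt (2 * Real.pi) := by
  simp [gaussianPDFReal]; ring

lemma kernel_eq (r σ s v : ℝ) (hσ : 0 < σ) (hs : 0 < s) (hv : 0 < v) (h : ℝ → ℝ) :
    ∫ x in Set.Ioi (0 : ℝ), h x * lnKernel r σ x s v = gEx r σ h s v := by
  set c := σ * Real.sqrt v with hc
  have hsv : 0 < Real.sqrt v := Real.sqrt_pos.2 hv
  have hcpos : 0 < c := mul_pos hσ hsv
  set m := (r - σ ^ 2 / 2) * v with hm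
  let fz : ℝ → ℝ := fun z => s * Real.exp (m + c * z)
  have himg : fz '' Set.univ = Set.Ioi 0 := by
    ext x
    simp only [Set.image_univ, Set.mem_range, Set.mem_Ioi, fz]
    constructor
    · rintro ⟨z, rfl⟩; positivity
    · intro hx
      refine ⟨(Real.log (x / s) - m) / c, ?_⟩
      have : m + c * ((Real.log (x / s) - m) / c) = Real.log (x / s) := by field_simp; ring
      rw [this, Real.exp_log (by positivity)]; field_simp
  have hder : ∀ z ∈ (Set.univ : Set ℝ), HasDerivWithinAt fz (c * fz z) Set.univ z := by
    intro z _
    have h1 : HasDerivAt (fun z : ℝ => m + c * z) c z := by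
      simpa using ((hasDerivAt_id z).const_mul c).const_add m
    have := (h1.exp.const_mul s).hasDerivWithinAt (s := Set.univ)
    refine this.congr_deriv ?_
    change s * (Real.exp (m + c * z) * c) = c * (s * Real.exp (m + c * z))
    ring
  have hinj : Set.InjOn fz Set.univ := by
    intro a _ b _ hab
    have h1 : Real.exp (m + c * a) = Real.exp (m + c * b) := mul_left_cancel₀ hs.ne' hab
    have h2 := Real.exp_injective h1
    exact mul_left_cancel₀ hcpos.ne' (by linarith)
  rw [← himg, integral_image_eq_integral_abs_deriv_smul MeasurableSet.univ hder hinj, gEx,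
    integral_gaussianReal_eq_integral_smul one_ne_zero, setIntegral_univ]
  refine integral_congr_ae (Filter.Eventually.of_forall fun z => ?_)
  have hfz : 0 < fz z := by simp only [fz]; positivity
  have hL : lnL r σ (fz z) s v = z := by
    unfold lnL
    have : fz z / s = Real.exp (m + c * z) := by simp only [fz]; field_simp
    rw [this, Real.log_exp, ← hm, ← hc]; field_simp; ring
  simp only [smul_eq_mul, pdf01]
  unfold lnKernel
  rw [hL, abs_of_pos (mul_pos hcpos hfz)]
  change _ = _ * h (fz z)
  rw [hc]
  have : Real.sqrt (2 * Real.pi) ≠ 0 := by positivity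
  field_simp

lemma int_exp_abs (c : ℝ) : Integrable (fun z : ℝ => Real.exp (c * |z|)) (gaussianReal 0 1) :=
  integrable_exp_mul_abs (X := fun z => z) (integrable_exp_mul_gaussianReal c)
    (integrable_exp_mul_gaussianReal (-c))

lemma gEx_cont (r σ C : ℝ) (hC : 0 ≤ C) (g : ℝ → ℝ → ℝ) (hg : Continuous fun q : ℝ × ℝ => g q.1 q.2)
    (hb : ∀ t x, |g t x| ≤ C * (1 + |x|)) :
    Continuous fun q : ℝ × ℝ × ℝ => gEx r σ (g q.1) q.2.1 q.2.2 := by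
  rw [continuous_iff_continuousAt]
  intro q0
  unfold gEx
  set A := |q0.2.1| + 1
  set B := |q0.2.2| + 1
  have hcont : Continuous fun p : (ℝ × ℝ × ℝ) × ℝ =>
      g p.1.1 (p.1.2.1 * Real.exp ((r - σ ^ 2 / 2) * p.1.2.2 + σ * Real.sqrt p.1.2.2 * p.2)) :=
    hg.comp (g := fun q : ℝ × ℝ => g q.1 q.2)
      (f := fun p : (ℝ × ℝ × ℝ) × ℝ => (p.1.1, (p.1.2.1 * Real.exp ((r - σ ^ 2 / 2) * p.1.2.2 + σ * Real.sqrt p.1.2.2 * p.2)))) (by fun_prop)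
  refine continuousAt_of_dominated (bound := fun z => C * (1 + A * (Real.exp (|r - σ ^ 2 / 2| * B) *
      Real.exp ((|σ| * Real.sqrt B) * |z|)))) ?_ ?_ ?_ ?_
  · refine Eventually.of_forall fun q => Continuous.aestronglyMeasurable ?_
    exact hcont.comp (f := fun z : ℝ => (q, z)) (by fun_prop)
  · have h1 : ∀ᶠ q in 𝓝 q0, |q.2.1| < A := by
      have : Continuous fun q : ℝ × ℝ × ℝ => |q.2.1| := by fun_prop
      exact this.continuousAt.eventually_lt_const (by simp [A])
    have h2 : ∀ᶠ q in 𝓝 q0, |q.2.2| < B := by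
      have : Continuous fun q : ℝ × ℝ × ℝ => |q.2.2| := by fun_prop
      exact this.continuousAt.eventually_lt_const (by simp [B])
    filter_upwards [h1, h2] with q hq1 hq2
    refine Eventually.of_forall fun z => ?_
    rw [Real.norm_eq_abs]
    refine (hb _ _).trans ?_
    rw [abs_mul, Real.abs_exp, ← Real.exp_add]
    have hsq : Real.sqrt q.2.2 ≤ Real.sqrt B := Real.sqrt_le_sqrt ((le_abs_self _).trans hq2.le)
    have he : (r - σ ^ 2 / 2) * q.2.2 + σ * Real.sqrt q.2.2 * z ≤
        |r - σ ^ 2 / 2| * B + |σ| * Real.sqrt B * |z| := by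
      refine add_le_add ?_ ?_
      · refine (le_abs_self _).trans ?_
        rw [abs_mul]; gcongr
      · refine (le_abs_self _).trans ?_
        rw [abs_mul, abs_mul, abs_of_nonneg (Real.sqrt_nonneg q.2.2)]; gcongr
    gcongr
  · refine Integrable.const_mul ?_ _
    refine (integrable_const _).add ?_
    exact ((int_exp_abs _).const_mul _).const_mul _
  · refine Eventually.of_forall fun z => ?_
    exact (hcont.comp (f := fun q : ℝ × ℝ × ℝ => (q, z)) (by fun_prop)).continuousAt

lemma gEx_integrable (r σ C s v : ℝ) (h : ℝ → ℝ) (hg : Continuous h)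
    (hb : ∀ x, |h x| ≤ C * (1 + |x|)) :
    Integrable (fun z => h (s * Real.exp ((r - σ ^ 2 / 2) * v + σ * Real.sqrt v * z)))
      (gaussianReal 0 1) := by
  refine Integrable.mono' (g := fun z => C * (1 + |s| * (Real.exp ((r - σ ^ 2 / 2) * v) *
      Real.exp ((σ * Real.sqrt v) * z)))) ?_ ?_ ?_
  · refine Integrable.const_mul ?_ _
    refine (integrable_const _).add ?_
    exact ((integrable_exp_mul_gaussianReal _).const_mul _).const_mul _
  · exact Continuous.aestronglyMeasurable (by fun_prop)
  · refine Eventually.of_forall fun z => ?_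
    rw [Real.norm_eq_abs]
    refine (hb _).trans (le_of_eq ?_)
    rw [abs_mul, Real.abs_exp, ← Real.exp_add]

lemma gauss_mgf (c : ℝ) : ∫ z, Real.exp (c * z) ∂(gaussianReal 0 1) = Real.exp (c ^ 2 / 2) := by
  have := mgf_gaussianReal (p := gaussianReal 0 1) (X := id) (μ := 0) (v := 1) (by simp) c
  simpa [mgf] using this

lemma gEx_lin (r σ s v : ℝ) (hv : 0 ≤ v) (hs : 0 ≤ s) :
    gEx r σ (fun x => 1 + |x|) s v = 1 + s * Real.exp (r * v) := by
  unfold gEx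
  have h1 : ∀ z : ℝ, 1 + |s * Real.exp ((r - σ ^ 2 / 2) * v + σ * Real.sqrt v * z)| =
      1 + s * Real.exp ((r - σ ^ 2 / 2) * v) * Real.exp (σ * Real.sqrt v * z) := by
    intro z
    rw [abs_mul, Real.abs_exp, Real.exp_add, abs_of_nonneg hs]; ring
  simp_rw [h1]
  rw [integral_add (integrable_const _) ((integrable_exp_mul_gaussianReal _).const_mul _),
    integral_const_mul, gauss_mgf]
  simp only [integral_const, probReal_univ, smul_eq_mul, mul_one]
  rw [mul_assoc, ← Real.exp_add]
  congr 3
  rw [mul_pow, Real.sq_sqrt hv]; ring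

lemma gEx_abs_le (r σ C s v : ℝ) (hv : 0 ≤ v) (hs : 0 ≤ s) (h : ℝ → ℝ)
    (hb : ∀ x, |h x| ≤ C * (1 + |x|)) :
    |gEx r σ h s v| ≤ C * (1 + s * Real.exp (r * v)) := by
  rw [← gEx_lin r σ s v hv hs]
  unfold gEx
  rw [← integral_const_mul, ← Real.norm_eq_abs]
  refine norm_integral_le_of_norm_le ?_ (Eventually.of_forall fun z => hb _)
  exact Integrable.const_mul (gEx_integrable r σ 1 s v (fun x => 1 + |x|) (by fun_prop)
    (fun x => by rw [abs_of_nonneg (by positivity)]; simp)) _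

lemma cdf_shift (c a : ℝ) :
    ∫ z in Set.Ici a, Real.exp (-(c - z) ^ 2 / 2) / Real.sqrt (2 * Real.pi) = stdNormalCDF (c - a) := by
  unfold stdNormalCDF
  rw [← integral_indicator measurableSet_Ici, ← integral_indicator measurableSet_Iic,
    ← integral_sub_left_eq_self _ _ c]
  refine integral_congr_ae (Eventually.of_forall fun z => ?_)
  by_cases h : a ≤ c - z
  · have h' : z ≤ c - a := by linarith
    simp [Set.indicator, h, h']
  · have h' : ¬ z ≤ c - a := fun h2 => h (by linarith)
    simp [Set.indicator, h, h']

lemma bs_eq (r σ K T t s : ℝ) (hσ : 0 < σ) (hK : 0 < K) (ht : t ≤ T) (hs : 0 ≤ s) :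
    bsPrice r σ K T t s = Real.exp (-r * (T - t)) * gEx r σ (fun x => max (x - K) 0) s (T - t) := by
  rcases hs.eq_or_lt with rfl | hs
  · simp [bsPrice, gEx, hK.le]
  rcases ht.eq_or_lt with rfl | ht
  · simp [bsPrice, gEx, not_le.2 hs]
  unfold bsPrice
  rw [if_neg (not_le.2 hs), if_pos ht]
  set τ := T - t with hτ
  have hτ0 : 0 < τ := by simp only [hτ]; linarith
  have hsq : 0 < Real.sqrt τ := Real.sqrt_pos.2 hτ0
  set c := σ * Real.sqrt τ with hc
  have hc0 : 0 < c := mul_pos hσ hsq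
  have hc2 : c ^ 2 = σ ^ 2 * τ := by rw [hc, mul_pow, Real.sq_sqrt hτ0.le]
  set m := (r - σ ^ 2 / 2) * τ with hm
  set d := (Real.log (s / K) + m) / c with hd
  have hd1 : (Real.log (s / K) + (r + σ ^ 2 / 2) * τ) / c = d + c := by
    rw [hd, div_add' _ _ _ hc0.ne']; congr 1; rw [← sq, hc2, hm]; ring
  rw [hd1, add_sub_cancel_right]
  have hpos : ∀ z : ℝ, -d ≤ z ↔ 0 ≤ s * Real.exp (m + c * z) - K := by
    intro z
    have e1 : -d ≤ z ↔ 0 ≤ Real.log (s / K) + m + c * z := by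
      have : Real.log (s / K) + m = c * d := by rw [hd]; field_simp
      rw [this, ← mul_add]
      constructor
      · intro h; exact mul_nonneg hc0.le (by linarith)
      · intro h; have := nonneg_of_mul_nonneg_right h hc0; linarith
    rw [e1, sub_nonneg, ← Real.log_le_log_iff hK (by positivity), Real.log_mul hs.ne' (Real.exp_ne_zero _),
      Real.log_exp, Real.log_div hs.ne' hK.ne']
    constructor <;> intro h <;> linarith
  have hmax : ∀ z : ℝ, max (s * Real.exp (m + c * z) - K) 0 =
      (Set.Ici (-d)).indicator (fun z => s * Real.exp (m + c * z) - K) z := by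
    intro z
    by_cases h : -d ≤ z
    · rw [max_eq_left ((hpos z).1 h), Set.indicator_of_mem (by exact h)]
    · rw [Set.indicator_of_notMem (by exact h), max_eq_right]
      by_contra h'
      exact h ((hpos z).2 (by push Not at h'; exact h'.le))
  have hint : ∫ z, max (s * Real.exp (m + c * z) - K) 0 ∂(gaussianReal 0 1) =
      s * Real.exp (r * τ) * stdNormalCDF (d + c) - K * stdNormalCDF d := by
    simp_rw [hmax]
    rw [integral_gaussianReal_eq_integral_smul one_ne_zero]
    have e1 : ∀ z, gaussianPDFReal 0 1 z • (Set.Ici (-d)).indicator (fun z => s * Real.exp (m + c * z) - K) z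
        = (Set.Ici (-d)).indicator (fun z => (s * Real.exp (r * τ)) * (Real.exp (-(c - z) ^ 2 / 2) / Real.sqrt (2 * Real.pi))
          - K * (Real.exp (-(0 - z) ^ 2 / 2) / Real.sqrt (2 * Real.pi))) z := by
      intro z
      by_cases h : z ∈ Set.Ici (-d)
      · rw [Set.indicator_of_mem h, Set.indicator_of_mem h, smul_eq_mul, pdf01]
        have e2 : Real.exp (-z ^ 2 / 2) * Real.exp (m + c * z) =
            Real.exp (r * τ) * Real.exp (-(c - z) ^ 2 / 2) := by
          rw [← Real.exp_add, ← Real.exp_add]; congr 1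
          have : m = r * τ - c ^ 2 / 2 := by rw [hc2, hm]; ring
          rw [this]; ring
        have e3 : (0 - z) ^ 2 = z ^ 2 := by ring
        rw [e3]
        have e4 : s * Real.exp (r * τ) * (Real.exp (-(c - z) ^ 2 / 2) / Real.sqrt (2 * Real.pi)) =
          s * (Real.exp (r * τ) * Real.exp (-(c - z) ^ 2 / 2)) / Real.sqrt (2 * Real.pi) := by ring
        rw [e4, ← e2]; ring
      · rw [Set.indicator_of_notMem h, Set.indicator_of_notMem h, smul_zero]
    simp_rw [e1]
    have hI : ∀ b : ℝ, Integrable fun z : ℝ => Real.exp (-(b - z) ^ 2 / 2) / Real.sqrt (2 * Real.pi) := by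
      intro b
      have := (integrable_gaussianPDFReal 0 1).comp_sub_left b
      simp_rw [pdf01] at this
      exact this
    rw [integral_indicator measurableSet_Ici, integral_sub ((hI c).integrableOn.const_mul _) ((hI 0).integrableOn.const_mul _),
      integral_const_mul, integral_const_mul, cdf_shift, cdf_shift]
    congr 3
    · ring
    · ring
  unfold gEx
  rw [hint]
  have : Real.exp (-r * τ) * Real.exp (r * τ) = 1 := by rw [← Real.exp_add]; simp
  linear_combination (-s * stdNormalCDF (d + c)) * this

/-- The integral part of the operator. -/
noncomputable def Jop (r σ : ℝ) (fp Fp : ℝ → ℝ) (T : ℝ) (G : ℝ → ℝ → ℝ) (t s y : ℝ) : ℝ :=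
  ∫ v in (0 : ℝ)..(T - t), Real.exp (-r * v) * (fp (y + v) / (1 - Fp y)) * gEx r σ (G (t + v)) s v

section J
variable (r σ : ℝ) (fp Fp : ℝ → ℝ) (T : ℝ)

lemma J_integrand_cont (hfp : Continuous fp) (hFp : Continuous Fp) (hF1 : ∀ y, Fp y < 1)
    (C : ℝ) (hC : 0 ≤ C) (G : ℝ → ℝ → ℝ) (hG : Continuous fun q : ℝ × ℝ => G q.1 q.2)
    (hb : ∀ t x, |G t x| ≤ C * (1 + |x|)) :
    Continuous (Function.uncurry fun (q : ℝ × ℝ × ℝ) (v : ℝ) =>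
      Real.exp (-r * v) * (fp (q.2.2 + v) / (1 - Fp q.2.2)) * gEx r σ (G (q.1 + v)) q.2.1 v) := by
  have h1 := (gEx_cont r σ C hC G hG hb).comp
    (f := fun p : (ℝ × ℝ × ℝ) × ℝ => (p.1.1 + p.2, p.1.2.1, p.2)) (by fun_prop)
  have h2 : Continuous fun p : (ℝ × ℝ × ℝ) × ℝ =>
      Real.exp (-r * p.2) * (fp (p.1.2.2 + p.2) / (1 - Fp p.1.2.2)) := by
    refine Continuous.mul (by fun_prop) (Continuous.div (by fun_prop) (by fun_prop) ?_)
    intro p; have := hF1 p.1.2.2; linarith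
  exact h2.mul h1

lemma J_cont (hfp : Continuous fp) (hFp : Continuous Fp) (hF1 : ∀ y, Fp y < 1)
    (C : ℝ) (hC : 0 ≤ C) (G : ℝ → ℝ → ℝ) (hG : Continuous fun q : ℝ × ℝ => G q.1 q.2)
    (hb : ∀ t x, |G t x| ≤ C * (1 + |x|)) :
    Continuous fun q : ℝ × ℝ × ℝ => Jop r σ fp Fp T G q.1 q.2.1 q.2.2 := by
  unfold Jop
  exact intervalIntegral.continuous_parametric_intervalIntegral_of_continuous
    (J_integrand_cont r σ fp Fp hfp hFp hF1 C hC G hG hb) (by fun_prop)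

lemma J_ii (hfp : Continuous fp) (hFp : Continuous Fp) (hF1 : ∀ y, Fp y < 1)
    (C : ℝ) (hC : 0 ≤ C) (G : ℝ → ℝ → ℝ) (hG : Continuous fun q : ℝ × ℝ => G q.1 q.2)
    (hb : ∀ t x, |G t x| ≤ C * (1 + |x|)) (t s y a b : ℝ) :
    IntervalIntegrable (fun v => Real.exp (-r * v) * (fp (y + v) / (1 - Fp y)) *
      gEx r σ (G (t + v)) s v) volume a b := by
  have := (J_integrand_cont r σ fp Fp hfp hFp hF1 C hC G hG hb).comp
    (f := fun v : ℝ => (((t, s, y) : ℝ × ℝ × ℝ), v)) (by fun_prop)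
  exact this.intervalIntegrable a b

lemma cont_slice {G : ℝ → ℝ → ℝ} (hG : Continuous fun q : ℝ × ℝ => G q.1 q.2) (t : ℝ) :
    Continuous (G t) :=
  hG.comp (f := fun x : ℝ => (t, x)) (by fun_prop)

lemma J_sub (hfp : Continuous fp) (hFp : Continuous Fp) (hF1 : ∀ y, Fp y < 1)
    (C : ℝ) (hC : 0 ≤ C) (G G' : ℝ → ℝ → ℝ) (hG : Continuous fun q : ℝ × ℝ => G q.1 q.2)
    (hb : ∀ t x, |G t x| ≤ C * (1 + |x|)) (hG' : Continuous fun q : ℝ × ℝ => G' q.1 q.2)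
    (hb' : ∀ t x, |G' t x| ≤ C * (1 + |x|)) (t s y : ℝ) :
    Jop r σ fp Fp T G t s y - Jop r σ fp Fp T G' t s y =
      Jop r σ fp Fp T (fun t x => G t x - G' t x) t s y := by
  unfold Jop
  rw [← intervalIntegral.integral_sub (J_ii r σ fp Fp hfp hFp hF1 C hC G hG hb _ _ _ _ _)
    (J_ii r σ fp Fp hfp hFp hF1 C hC G' hG' hb' _ _ _ _ _)]
  refine intervalIntegral.integral_congr fun v _ => ?_
  have : gEx r σ (fun x => G (t + v) x - G' (t + v) x) s v =
      gEx r σ (G (t + v)) s v - gEx r σ (G' (t + v)) s v := by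
    unfold gEx
    exact integral_sub (gEx_integrable r σ C s v _ (cont_slice hG _) (hb _))
      (gEx_integrable r σ C s v _ (cont_slice hG' _) (hb' _))
  simp only [this]
  ring

lemma gEx_nonneg (h : ℝ → ℝ) (hh : ∀ x, 0 ≤ h x) (s v : ℝ) : 0 ≤ gEx r σ h s v :=
  integral_nonneg fun _ => hh _

lemma J_nonneg (hf0 : ∀ y, 0 ≤ fp y) (hF1 : ∀ y, Fp y < 1) (G : ℝ → ℝ → ℝ)
    (hG : ∀ t x, 0 ≤ G t x) (t s y : ℝ) (ht : t ≤ T) : 0 ≤ Jop r σ fp Fp T G t s y := by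
  unfold Jop
  refine intervalIntegral.integral_nonneg (by linarith) fun v _ => ?_
  have h1 := gEx_nonneg r σ (G (t + v)) (hG _) s v
  have h2 := hF1 y
  exact mul_nonneg (mul_nonneg (Real.exp_pos _).le (div_nonneg (hf0 _) (by linarith))) h1

lemma J_zero (G : ℝ → ℝ → ℝ) (hG : ∀ t, G t 0 = 0) (t y : ℝ) : Jop r σ fp Fp T G t 0 y = 0 := by
  simp [Jop, gEx, hG]

lemma J_bound (hr : 0 ≤ r) (hfp : Continuous fp) (hf0 : ∀ y, 0 ≤ fp y) (hF1 : ∀ y, Fp y < 1)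
    (hF0 : ∀ y, 0 ≤ Fp y) (hmono : Monotone Fp)
    (hFint : ∀ a b, 0 ≤ a → 0 ≤ b → ∫ v in (0 : ℝ)..b, fp (a + v) = Fp (a + b) - Fp a)
    (C : ℝ) (hC : 0 ≤ C) (G : ℝ → ℝ → ℝ)
    (hb : ∀ t x, |G t x| ≤ C * (1 + |x|)) (t s y : ℝ) (ht : t ≤ T) (hs : 0 ≤ s) (hy : 0 ≤ y)
    (hyt : y ≤ t) :
    |Jop r σ fp Fp T G t s y| ≤ Fp T * C * (1 + s) := by
  have hden : 0 < 1 - Fp y := by linarith [hF1 y]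
  have h1 : |Jop r σ fp Fp T G t s y| ≤ ∫ v in (0 : ℝ)..(T - t), (C * (1 + s) / (1 - Fp y)) * fp (y + v) := by
    unfold Jop
    rw [← Real.norm_eq_abs]
    refine intervalIntegral.norm_integral_le_of_norm_le (by linarith) ?_ ?_
    · refine Eventually.of_forall fun v hv => ?_
      have hv0 : 0 ≤ v := hv.1.le
      have h2 := gEx_abs_le r σ C s v hv0 hs (G (t + v)) (hb _)
      rw [Real.norm_eq_abs, abs_mul, abs_mul, Real.abs_exp, abs_of_nonneg (div_nonneg (hf0 _) hden.le)]
      have h3 : Real.exp (-r * v) * |gEx r σ (G (t + v)) s v| ≤ C * (1 + s) := by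
        have e1 : Real.exp (-r * v) ≤ 1 := Real.exp_le_one_iff.2 (by nlinarith)
        have e2 : Real.exp (-r * v) * Real.exp (r * v) = 1 := by rw [← Real.exp_add]; simp
        calc _ ≤ Real.exp (-r * v) * (C * (1 + s * Real.exp (r * v))) := by gcongr
          _ = C * (Real.exp (-r * v) + s * (Real.exp (-r * v) * Real.exp (r * v))) := by ring
          _ ≤ C * (1 + s) := by rw [e2, mul_one]; gcongr
      calc _ = (Real.exp (-r * v) * |gEx r σ (G (t + v)) s v|) * (fp (y + v) / (1 - Fp y)) := by ring
        _ ≤ (C * (1 + s)) * (fp (y + v) / (1 - Fp y)) :=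
          mul_le_mul_of_nonneg_right h3 (div_nonneg (hf0 _) hden.le)
        _ = _ := by ring
    · exact Continuous.intervalIntegrable (by fun_prop) _ _
  rw [intervalIntegral.integral_const_mul, hFint y (T - t) hy (by linarith)] at h1
  refine h1.trans ?_
  have hle : Fp (y + (T - t)) ≤ Fp T := hmono (by linarith)
  have h4 : Fp (y + (T - t)) - Fp y ≤ Fp T * (1 - Fp y) := by nlinarith [hF0 y, hF1 T]
  have h5 : 0 ≤ C * (1 + s) := by positivity
  rw [div_mul_eq_mul_div, div_le_iff₀ hden]
  nlinarith [mul_le_mul_of_nonneg_left h4 h5]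

/-- The first term of the operator. -/
noncomputable def Bterm (K t s y : ℝ) : ℝ :=
  (1 - Fp (T - t + y)) / (1 - Fp y) *
    (Real.exp (-r * (T - t)) * gEx r σ (fun x => max (x - K) 0) s (T - t))

lemma pay_bd (K : ℝ) (hK : 0 < K) (x : ℝ) : |max (x - K) 0| ≤ 1 * (1 + |x|) := by
  rw [abs_of_nonneg (le_max_right _ _)]
  refine max_le ?_ (by positivity)
  have := le_abs_self x
  linarith

lemma B_cont (hFp : Continuous Fp) (hF1 : ∀ y, Fp y < 1) (K : ℝ) (hK : 0 < K) :
    Continuous fun q : ℝ × ℝ × ℝ => Bterm r σ Fp T K q.1 q.2.1 q.2.2 := by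
  unfold Bterm
  have h1 := (gEx_cont r σ 1 zero_le_one (fun _ x => max (x - K) 0) (by fun_prop)
    (fun _ x => pay_bd K hK x)).comp
    (f := fun p : ℝ × ℝ × ℝ => (p.1, p.2.1, T - p.1)) (by fun_prop)
  have h2 : Continuous fun p : ℝ × ℝ × ℝ => (1 - Fp (T - p.1 + p.2.2)) / (1 - Fp p.2.2) := by
    refine Continuous.div (by fun_prop) (by fun_prop) ?_
    intro p; have := hF1 p.2.2; linarith
  exact h2.mul (Continuous.mul (by fun_prop) h1)

lemma B_nonneg (hF1 : ∀ y, Fp y < 1) (K t s y : ℝ) : 0 ≤ Bterm r σ Fp T K t s y := by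
  unfold Bterm
  have h1 := hF1 y
  have h2 := hF1 (T - t + y)
  exact mul_nonneg (div_nonneg (by linarith) (by linarith))
    (mul_nonneg (Real.exp_pos _).le (gEx_nonneg r σ _ (fun x => le_max_right _ _) _ _))

lemma B_zero (K t y : ℝ) (hK : 0 < K) : Bterm r σ Fp T K t 0 y = 0 := by
  simp [Bterm, gEx, hK.le]

lemma B_bound (hr : 0 ≤ r) (hF1 : ∀ y, Fp y < 1) (hmono : Monotone Fp) (K t s y : ℝ) (hK : 0 < K)
    (ht : t ≤ T) (hs : 0 ≤ s) : |Bterm r σ Fp T K t s y| ≤ 1 * (1 + s) := by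
  unfold Bterm
  have h1 := hF1 y
  have h2 := hF1 (T - t + y)
  have h3 : Fp y ≤ Fp (T - t + y) := hmono (by linarith)
  rw [abs_mul, abs_mul, Real.abs_exp, abs_of_nonneg (div_nonneg (by linarith) (by linarith))]
  have h4 : (1 - Fp (T - t + y)) / (1 - Fp y) ≤ 1 := by
    rw [div_le_one (by linarith)]; linarith
  have h5 := gEx_abs_le r σ 1 s (T - t) (by linarith) hs (fun x => max (x - K) 0) (pay_bd K hK)
  set v := T - t
  have hv : 0 ≤ v := by simp only [v]; linarith
  have e1 : Real.exp (-r * v) ≤ 1 := Real.exp_le_one_iff.2 (by nlinarith)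
  have e2 : Real.exp (-r * v) * Real.exp (r * v) = 1 := by rw [← Real.exp_add]; simp
  refine mul_le_mul h4 ?_ (by positivity) zero_le_one
  calc _ ≤ Real.exp (-r * v) * (1 * (1 + s * Real.exp (r * v))) := by gcongr
    _ = (Real.exp (-r * v) + s * (Real.exp (-r * v) * Real.exp (r * v))) := by ring
    _ ≤ 1 + s := by rw [e2, mul_one]; gcongr

end J

lemma dom_sub_closure (T : ℝ) (hT : 0 < T) : domDbar T ⊆ closure (domD T) := by
  intro q hq
  have h1 : q ∈ closure (openSegment ℝ q ((T / 2, 1, T / 4) : ℝ × ℝ × ℝ)) := by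
    rw [closure_openSegment]; exact left_mem_segment _ _ _
  refine closure_mono ?_ h1
  rintro _ ⟨a, b, ha, hb, hab, rfl⟩
  obtain ⟨h1, h2, h3, h4, h5⟩ := hq
  obtain rfl : a = 1 - b := by linarith
  simp only [domD, Set.mem_ofPred_eq, Prod.fst_add, Prod.snd_add, Prod.smul_fst, Prod.smul_snd, smul_eq_mul]
  have hbT : 0 < b * T := mul_pos hb hT
  have i1 := mul_nonneg ha.le h1
  have i2 := mul_nonneg ha.le (sub_nonneg.2 h2)
  have i3 := mul_nonneg ha.le h3
  have i4 := mul_nonneg ha.le h4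
  have i5 := mul_nonneg ha.le (sub_nonneg.2 h5)
  refine ⟨?_, ?_, ?_, ?_, ?_⟩ <;> nlinarith

/-- Properties of the (extended) holding-time density and distribution function. -/
structure GoodPair (fp Fp : ℝ → ℝ) : Prop where
  hfp : Continuous fp
  hf0 : ∀ y, 0 ≤ fp y
  hFp : Continuous Fp
  hF1 : ∀ y, Fp y < 1
  hF0 : ∀ y, 0 ≤ Fp y
  hmono : Monotone Fp
  hFint : ∀ a b, 0 ≤ a → 0 ≤ b → ∫ v in (0 : ℝ)..b, fp (a + v) = Fp (a + b) - Fp a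

lemma goodPair_of (f F : ℝ → ℝ) (hc : ContinuousOn f (Set.Ici 0)) (hfnn : ∀ y, 0 ≤ y → 0 ≤ f y)
    (hFdef : ∀ y, F y = ∫ u in (0 : ℝ)..y, f u) (hFlt : ∀ y, 0 ≤ y → F y < 1) :
    GoodPair (fun y => f (max y 0)) (fun y => F (max y 0)) := by
  have hfp : Continuous fun y => f (max y 0) :=
    hc.comp_continuous (by fun_prop) (fun y => le_max_right y 0)
  have hf0 : ∀ y, 0 ≤ f (max y 0) := fun y => hfnn _ (le_max_right _ _)
  have hP : ∀ y, 0 ≤ y → F y = ∫ u in (0 : ℝ)..y, f (max u 0) := by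
    intro y hy
    rw [hFdef]
    refine intervalIntegral.integral_congr fun u hu => ?_
    rw [Set.uIcc_of_le hy] at hu
    simp only [max_eq_left hu.1]
  have hii : ∀ a b, IntervalIntegrable (fun u => f (max u 0)) volume a b :=
    fun a b => hfp.intervalIntegrable a b
  have hdiff : ∀ a b, 0 ≤ a → 0 ≤ b → ∫ u in a..b, f (max u 0) = F b - F a := by
    intro a b ha hb
    rw [hP a ha, hP b hb, intervalIntegral.integral_interval_sub_left (hii _ _) (hii _ _)]
  have hF0 : F 0 = 0 := by simp [hFdef]
  have hmon : ∀ a b, 0 ≤ a → a ≤ b → F a ≤ F b := by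
    intro a b ha hab
    have := hdiff a b ha (ha.trans hab)
    have h2 : 0 ≤ ∫ u in a..b, f (max u 0) := intervalIntegral.integral_nonneg hab fun u _ => hf0 u
    linarith
  refine ⟨hfp, hf0, ?_, fun y => hFlt _ (le_max_right _ _), ?_, ?_, ?_⟩
  · have : (fun y => F (max y 0)) = fun y => ∫ u in (0 : ℝ)..(max y 0), f (max u 0) := by
      funext y; exact hP _ (le_max_right _ _)
    rw [this]
    exact intervalIntegral.continuous_parametric_intervalIntegral_of_continuous
      (f := fun _ u => f (max u 0)) (hfp.comp continuous_snd) (by fun_prop)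
  · intro y
    exact hF0.symm.le.trans (hmon _ _ le_rfl (le_max_right _ _))
  · intro a b hab
    exact hmon _ _ (le_max_right _ _) (max_le_max hab le_rfl)
  · intro a b ha hb
    rw [intervalIntegral.integral_comp_add_left (fun u => f (max u 0)), add_zero,
      hdiff _ _ ha (by linarith), max_eq_left ha, max_eq_left (by linarith)]

section Fix
variable {k : ℕ} (r σ : Fin k → ℝ) (p : Fin k → Fin k → ℝ) (fp Fp : Fin k → ℝ → ℝ) (K T : ℝ)

/-- Weighted average of the components. -/
noncomputable def gw (w : BoundedContinuousFunction (Fin k × ℝ × ℝ) ℝ) (i : Fin k) (t x : ℝ) : ℝ :=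
  ∑ j, p i j * (w (j, t, x) * (1 + |x|))

/-- The full operator. -/
noncomputable def RG (w : BoundedContinuousFunction (Fin k × ℝ × ℝ) ℝ) (i : Fin k) (t s y : ℝ) : ℝ :=
  Bterm (r i) (σ i) (Fp i) T K t s y + Jop (r i) (σ i) (fp i) (Fp i) T (gw p w i) t s y

lemma gw_cont (w : BoundedContinuousFunction (Fin k × ℝ × ℝ) ℝ) (i : Fin k) :
    Continuous fun q : ℝ × ℝ => gw p w i q.1 q.2 := by
  unfold gw
  refine continuous_finsetSum _ fun j _ => ?_
  have := w.continuous
  fun_prop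

lemma gw_bd (hp0 : ∀ i j, 0 ≤ p i j) (hp1 : ∀ i, ∑ j, p i j = 1)
    (w : BoundedContinuousFunction (Fin k × ℝ × ℝ) ℝ) (i : Fin k) (t x : ℝ) :
    |gw p w i t x| ≤ ‖w‖ * (1 + |x|) := by
  unfold gw
  calc _ ≤ ∑ j, |p i j * (w (j, t, x) * (1 + |x|))| := Finset.abs_sum_le_sum_abs _ _
    _ ≤ ∑ j, p i j * (‖w‖ * (1 + |x|)) := by
      refine Finset.sum_le_sum fun j _ => ?_
      rw [abs_mul, abs_mul, abs_of_nonneg (hp0 i j), abs_of_nonneg (by positivity : 0 ≤ 1 + |x|)]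
      have := w.norm_coe_le_norm (j, t, x)
      rw [Real.norm_eq_abs] at this
      have := hp0 i j
      gcongr
    _ = _ := by rw [← Finset.sum_mul, hp1, one_mul]

lemma RG_cont (hK : 0 < K) (hg : ∀ i, GoodPair (fp i) (Fp i)) (hp0 : ∀ i j, 0 ≤ p i j)
    (hp1 : ∀ i, ∑ j, p i j = 1)
    (w : BoundedContinuousFunction (Fin k × ℝ × ℝ) ℝ) (i : Fin k) :
    Continuous fun q : ℝ × ℝ × ℝ => RG r σ p fp Fp K T w i q.1 q.2.1 q.2.2 :=
  (B_cont (r i) (σ i) (Fp i) T (hg i).hFp (hg i).hF1 K hK).add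
    (J_cont (r i) (σ i) (fp i) (Fp i) T (hg i).hfp (hg i).hFp (hg i).hF1 ‖w‖ (norm_nonneg _) _
      (gw_cont p w i) (gw_bd p hp0 hp1 w i))

lemma RG_bd (hK : 0 < K) (hr : ∀ i, 0 ≤ r i) (hg : ∀ i, GoodPair (fp i) (Fp i))
    (hp0 : ∀ i j, 0 ≤ p i j) (hp1 : ∀ i, ∑ j, p i j = 1)
    (w : BoundedContinuousFunction (Fin k × ℝ × ℝ) ℝ) (i : Fin k) (t s y : ℝ)
    (ht : t ≤ T) (hs : 0 ≤ s) (hy : 0 ≤ y) (hyt : y ≤ t) :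
    |RG r σ p fp Fp K T w i t s y| ≤ (1 + ‖w‖) * (1 + s) := by
  unfold RG
  have h1 := B_bound (r i) (σ i) (Fp i) T (hr i) (hg i).hF1 (hg i).hmono K t s y hK ht hs
  have h2 := J_bound (r i) (σ i) (fp i) (Fp i) T (hr i) (hg i).hfp (hg i).hf0 (hg i).hF1 (hg i).hF0
    (hg i).hmono (hg i).hFint ‖w‖ (norm_nonneg _) (gw p w i) (gw_bd p hp0 hp1 w i) t s y ht hs hy hyt
  have h3 := (hg i).hF1 T
  have h4 : 0 ≤ ‖w‖ * (1 + s) := by positivity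
  have h5 := abs_add_le (Bterm (r i) (σ i) (Fp i) T K t s y)
    (Jop (r i) (σ i) (fp i) (Fp i) T (gw p w i) t s y)
  nlinarith

lemma RG_sub (hr : ∀ i, 0 ≤ r i) (hg : ∀ i, GoodPair (fp i) (Fp i))
    (hp0 : ∀ i j, 0 ≤ p i j) (hp1 : ∀ i, ∑ j, p i j = 1)
    (w w' : BoundedContinuousFunction (Fin k × ℝ × ℝ) ℝ) (i : Fin k) (t s y : ℝ)
    (ht : t ≤ T) (hs : 0 ≤ s) (hy : 0 ≤ y) (hyt : y ≤ t) :
    |RG r σ p fp Fp K T w i t s y - RG r σ p fp Fp K T w' i t s y| ≤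
      Fp i T * ‖w - w'‖ * (1 + s) := by
  unfold RG
  rw [add_sub_add_left_eq_sub]
  have hb1 : ∀ t x, |gw p w i t x| ≤ (max ‖w‖ ‖w'‖) * (1 + |x|) := fun t x =>
    (gw_bd p hp0 hp1 w i t x).trans (by gcongr; exact le_max_left _ _)
  have hb2 : ∀ t x, |gw p w' i t x| ≤ (max ‖w‖ ‖w'‖) * (1 + |x|) := fun t x =>
    (gw_bd p hp0 hp1 w' i t x).trans (by gcongr; exact le_max_right _ _)
  rw [J_sub (r i) (σ i) (fp i) (Fp i) T (hg i).hfp (hg i).hFp (hg i).hF1 (max ‖w‖ ‖w'‖)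
    (le_max_of_le_left (norm_nonneg _)) _ _ (gw_cont p w i) hb1 (gw_cont p w' i) hb2]
  have he : (fun t x => gw p w i t x - gw p w' i t x) = gw p (w - w') i := by
    funext t x
    unfold gw
    rw [← Finset.sum_sub_distrib]
    refine Finset.sum_congr rfl fun j _ => ?_
    rw [BoundedContinuousFunction.sub_apply]; ring
  rw [he]
  exact J_bound (r i) (σ i) (fp i) (Fp i) T (hr i) (hg i).hfp (hg i).hf0 (hg i).hF1 (hg i).hF0
    (hg i).hmono (hg i).hFint _ (norm_nonneg _) (gw p (w - w') i) (gw_bd p hp0 hp1 _ i) t s y ht hs hy hyt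

lemma RG_nonneg (hg : ∀ i, GoodPair (fp i) (Fp i)) (hp0 : ∀ i j, 0 ≤ p i j)
    (w : BoundedContinuousFunction (Fin k × ℝ × ℝ) ℝ) (hw : ∀ x, 0 ≤ w x) (i : Fin k) (t s y : ℝ)
    (ht : t ≤ T) : 0 ≤ RG r σ p fp Fp K T w i t s y := by
  refine add_nonneg (B_nonneg _ _ _ _ (hg i).hF1 _ _ _ _)
    (J_nonneg _ _ _ _ _ (hg i).hf0 (hg i).hF1 _ ?_ _ _ _ ht)
  intro t x
  exact Finset.sum_nonneg fun j _ => mul_nonneg (hp0 i j) (mul_nonneg (hw _) (by positivity))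

lemma RG_zero (hK : 0 < K) (w : BoundedContinuousFunction (Fin k × ℝ × ℝ) ℝ)
    (hw : ∀ j t, w (j, t, 0) = 0) (i : Fin k) (t y : ℝ) :
    RG r σ p fp Fp K T w i t 0 y = 0 := by
  unfold RG
  rw [B_zero _ _ _ _ _ _ _ hK, J_zero, add_zero]
  intro t
  simp [gw, hw]

/-- Projection onto `[0,T]`. -/
noncomputable def clT (t : ℝ) : ℝ := max 0 (min t T)

lemma fix_exists (hk : 1 ≤ k) (hT : 0 < T) (hK : 0 < K) (hr : ∀ i, 0 ≤ r i)
    (hg : ∀ i, GoodPair (fp i) (Fp i)) (hp0 : ∀ i j, 0 ≤ p i j) (hp1 : ∀ i, ∑ j, p i j = 1) :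
    ∃ w : BoundedContinuousFunction (Fin k × ℝ × ℝ) ℝ,
      (∀ i t s, w (i, t, s) = RG r σ p fp Fp K T w i (clT T t) (max s 0) 0 / (1 + max s 0)) ∧
      (∀ x, 0 ≤ w x) ∧ (∀ j t, w (j, t, 0) = 0) ∧
      ∀ w' : BoundedContinuousFunction (Fin k × ℝ × ℝ) ℝ,
        (∀ i t s, w' (i, t, s) = RG r σ p fp Fp K T w' i (clT T t) (max s 0) 0 / (1 + max s 0)) →
        w' = w := by
  have hcl0 : ∀ t, 0 ≤ clT T t := fun t => le_max_left _ _
  have hclT : ∀ t, clT T t ≤ T := fun t => max_le hT.le (min_le_right _ _)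
  have hs0 : ∀ s : ℝ, 0 ≤ max s 0 := fun s => le_max_right _ _
  have hs1 : ∀ s : ℝ, 0 < 1 + max s 0 := fun s => by have := hs0 s; linarith
  let A : BoundedContinuousFunction (Fin k × ℝ × ℝ) ℝ → BoundedContinuousFunction (Fin k × ℝ × ℝ) ℝ :=
    fun w => BoundedContinuousFunction.ofNormedAddCommGroup
      (fun x => RG r σ p fp Fp K T w x.1 (clT T x.2.1) (max x.2.2 0) 0 / (1 + max x.2.2 0))
      (by
        rw [continuous_prod_of_discrete_left]
        intro i
        refine Continuous.div ?_ (by fun_prop) fun q => (hs1 q.2).ne'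
        exact (RG_cont r σ p fp Fp K T hK hg hp0 hp1 w i).comp
          (f := fun q : ℝ × ℝ => (clT T q.1, max q.2 0, 0)) (by unfold clT; fun_prop))
      (1 + ‖w‖)
      (by
        intro x
        rw [Real.norm_eq_abs, abs_div, abs_of_pos (hs1 _), div_le_iff₀ (hs1 _)]
        exact RG_bd r σ p fp Fp K T hK hr hg hp0 hp1 w _ _ _ _ (hclT _) (hs0 _) le_rfl (hcl0 _))
  have hA : ∀ w i t s, A w (i, t, s) = RG r σ p fp Fp K T w i (clT T t) (max s 0) 0 / (1 + max s 0) :=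
    fun _ _ _ _ => rfl
  have : Nonempty (Fin k) := ⟨⟨0, hk⟩⟩
  obtain ⟨i0, hi0⟩ := Finite.exists_max fun i => Fp i T
  have hq0 : 0 ≤ Fp i0 T := (hg i0).hF0 T
  have hcon : ContractingWith ⟨Fp i0 T, hq0⟩ A := by
    refine ⟨?_, LipschitzWith.of_dist_le_mul fun w w' => ?_⟩
    · exact_mod_cast (hg i0).hF1 T
    · rw [dist_eq_norm w w', BoundedContinuousFunction.dist_le (by positivity)]
      rintro ⟨i, t, s⟩
      rw [hA, hA, Real.dist_eq, ← sub_div, abs_div, abs_of_pos (hs1 _), div_le_iff₀ (hs1 _)]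
      refine (RG_sub r σ p fp Fp K T hr hg hp0 hp1 w w' i _ _ _ (hclT _) (hs0 _) le_rfl (hcl0 _)).trans ?_
      have := hi0 i
      have := hs1 s
      change _ ≤ Fp i0 T * ‖w - w'‖ * (1 + max s 0)
      gcongr
  have hfix := hcon.fixedPoint_isFixedPt
  set w := ContractingWith.fixedPoint A hcon with hw
  have hlim := hcon.tendsto_iterate_fixedPoint 0
  have hiter : ∀ n, (∀ x, 0 ≤ (A^[n] 0) x) ∧ (∀ j t, (A^[n] 0) (j, t, 0) = 0) := by
    intro n
    induction n with
    | zero => simp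
    | succ n ih =>
      rw [Function.iterate_succ_apply']
      refine ⟨?_, ?_⟩
      · rintro ⟨i, t, s⟩
        rw [hA]
        exact div_nonneg (RG_nonneg r σ p fp Fp K T hg hp0 _ ih.1 _ _ _ _ (hclT _)) (hs1 _).le
      · intro j t
        rw [hA, max_self, RG_zero r σ p fp Fp K T hK _ ih.2, zero_div]
  have hev : ∀ x, Tendsto (fun n => (A^[n] 0) x) atTop (𝓝 (w x)) := fun x =>
    ((continuous_eval_const x).tendsto w).comp hlim
  refine ⟨w, ?_, ?_, ?_, ?_⟩
  · intro i t s
    rw [← hA, hfix]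
  · intro x
    exact ge_of_tendsto' (hev x) fun n => (hiter n).1 x
  · intro j t
    exact tendsto_nhds_unique (hev _) (by simp [(hiter _).2])
  · intro w' h'
    refine hcon.fixedPoint_unique ?_
    ext ⟨i, t, s⟩
    rw [hA, ← h']

lemma ie_eq (f F : Fin k → ℝ → ℝ) (hσ : ∀ i, 0 < σ i) (hK : 0 < K)
    (hp0 : ∀ i j, 0 ≤ p i j) (hp1 : ∀ i, ∑ j, p i j = 1)
    (w : BoundedContinuousFunction (Fin k × ℝ × ℝ) ℝ) (ψ : ℝ → ℝ → Fin k → ℝ → ℝ)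
    (hψ : ∀ t x j, 0 ≤ t → t ≤ T → 0 < x → ψ t x j 0 = w (j, t, x) * (1 + |x|))
    (t s y : ℝ) (i : Fin k) (ht0 : 0 ≤ t) (ht : t ≤ T) (hs : 0 < s) (hy : 0 ≤ y) :
    ieRHS r σ p f F K T ψ t s i y =
      RG r σ p (fun i y => f i (max y 0)) (fun i y => F i (max y 0)) K T w i t s y := by
  unfold ieRHS RG Bterm Jop
  beta_reduce
  rw [bs_eq (r i) (σ i) K T t s (hσ i) hK ht hs.le, max_eq_left (by linarith : 0 ≤ T - t + y),
    max_eq_left hy, intervalIntegral.integral_of_le (by linarith), integral_Ioc_eq_integral_Ioo]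
  congr 1
  refine setIntegral_congr_fun measurableSet_Ioo fun v hv => ?_
  beta_reduce
  rw [max_eq_left (by linarith [hv.1] : 0 ≤ y + v)]
  congr 1
  have h1 : ∀ j, ∫ x in Set.Ioi (0 : ℝ), ψ (t + v) x j 0 * lnKernel (r i) (σ i) x s v =
      gEx (r i) (σ i) (fun x => w (j, t + v, x) * (1 + |x|)) s v := by
    intro j
    rw [← kernel_eq (r i) (σ i) s v (hσ i) hs hv.1]
    refine setIntegral_congr_fun measurableSet_Ioi fun x hx => ?_
    beta_reduce
    rw [hψ (t + v) x j (by linarith [hv.1]) (by linarith [hv.2]) hx]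
  simp_rw [h1]
  unfold gEx gw
  have hc := w.continuous
  rw [integral_finset_sum]
  · refine Finset.sum_congr rfl fun j _ => ?_
    rw [integral_const_mul]
  · intro j _
    refine Integrable.const_mul ?_ _
    refine gEx_integrable (r i) (σ i) ‖w‖ s v (fun x => w (j, t + v, x) * (1 + |x|)) (by fun_prop) ?_
    intro x
    rw [abs_mul, abs_of_nonneg (by positivity : 0 ≤ 1 + |x|)]
    have := w.norm_coe_le_norm (j, t + v, x)
    rw [Real.norm_eq_abs] at this
    gcongr

end Fix
end Helpers

/-- The Volterra integral equation of the second kind has exactly one continuous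
solution on the closure of `D` with at most linear growth in `s`, and this
solution is non-negative. -/
theorem volterra_existence_uniqueness_nonneg
    (k : ℕ) (hk : 1 ≤ k) (T K : ℝ) (hT : 0 < T) (hK : 0 < K)
    (r σ : Fin k → ℝ) (hr : ∀ i, 0 ≤ r i) (hσ : ∀ i, 0 < σ i)
    (p : Fin k → Fin k → ℝ) (hp0 : ∀ i j, 0 ≤ p i j)
    (hp1 : ∀ i, ∑ j, p i j = 1) (hpd : ∀ i, p i i = 0)
    (f : Fin k → ℝ → ℝ)
    (hfC1 : ∀ i, ContDiffOn ℝ 1 (f i) (Set.Ici 0))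
    (hfbd : ∀ i, ∃ M : ℝ, ∀ y, 0 ≤ y → f i y ≤ M)
    (hfpos : ∀ i y, 0 < y → 0 < f i y)
    (hfnn : ∀ i y, 0 ≤ y → 0 ≤ f i y)
    (hfdens : ∀ i, ∫ u in Set.Ioi (0 : ℝ), f i u = 1)
    (F : Fin k → ℝ → ℝ) (hFdef : ∀ i y, F i y = ∫ u in (0 : ℝ)..y, f i u)
    (hFlt : ∀ i y, 0 ≤ y → F i y < 1) :
    ∃ φ : ℝ → ℝ → Fin k → ℝ → ℝ,
      (ContOnClosure T φ ∧ LinGrowth T φ ∧ SolvesIE r σ p f F K T φ) ∧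
      (∀ t s y : ℝ, (t, s, y) ∈ domDbar T → ∀ i, 0 ≤ φ t s i y) ∧
      (∀ ψ : ℝ → ℝ → Fin k → ℝ → ℝ,
        ContOnClosure T ψ ∧ LinGrowth T ψ ∧ SolvesIE r σ p f F K T ψ →
        ∀ t s y : ℝ, (t, s, y) ∈ domDbar T → ∀ i, ψ t s i y = φ t s i y) := by
  have hg : ∀ i, GoodPair (fun y => f i (max y 0)) (fun y => F i (max y 0)) := fun i =>
    goodPair_of (f i) (F i) (hfC1 i).continuousOn (hfnn i) (hFdef i) (hFlt i)
  obtain ⟨w, hw, hwn, hwz, huniq⟩ := fix_exists r σ p (fun i y => f i (max y 0))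
    (fun i y => F i (max y 0)) K T hk hT hK hr hg hp0 hp1
  have hcl : ∀ t, 0 ≤ t → t ≤ T → clT T t = t := by
    intro t h0 h1
    rw [clT, min_eq_left h1, max_eq_right h0]
  have hcl0 : ∀ t, 0 ≤ clT T t := fun t => le_max_left _ _
  have hclT : ∀ t, clT T t ≤ T := fun t => max_le hT.le (min_le_right _ _)
  have hsub : domD T ⊆ domDbar T := fun q hq =>
    ⟨hq.1.le, hq.2.1.le, hq.2.2.1.le, hq.2.2.2.1.le, hq.2.2.2.2.le⟩
  refine ⟨fun t s i y => RG r σ p (fun i y => f i (max y 0)) (fun i y => F i (max y 0)) K T w i t s y,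
    ⟨?_, ?_, ?_, ?_⟩, ?_, ?_⟩
  · intro i
    exact (RG_cont r σ p _ _ K T hK hg hp0 hp1 w i).continuousOn
  · refine ⟨1 + ‖w‖, fun t s y h i => ?_⟩
    obtain ⟨h1, h2, h3, h4, h5⟩ := hsub h
    exact RG_bd r σ p _ _ K T hK hr hg hp0 hp1 w i t s y h2 h3 h4 h5
  · intro t s y h i
    obtain ⟨h1, h2, h3, h4, h5⟩ := h
    symm
    refine ie_eq r σ p K T f F hσ hK hp0 hp1 w _ ?_ t s y i h1.le h2.le h3 h4.le
    intro t x j ht0 ht hx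
    rw [hw j t x, hcl t ht0 ht, max_eq_left hx.le, abs_of_pos hx, div_mul_cancel₀]
    linarith
  · intro t y i _ _ _ _
    exact RG_zero r σ p _ _ K T hK w hwz i t y
  · intro t s y h i
    exact RG_nonneg r σ p _ _ K T hg hp0 w hwn i t s y h.2.1
  · rintro ψ ⟨hψc, ⟨C, hψb⟩, hψe, hψ0⟩
    have hcl' := dom_sub_closure T hT
    have hψb' : ∀ i, ∀ q ∈ domDbar T, |ψ q.1 q.2.1 i q.2.2| ≤ C * (1 + q.2.1) := by
      intro i q hq
      have hmem : q ∈ closure (domD T) := hcl' hq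
      have hne : (nhdsWithin q (domD T)).NeBot := mem_closure_iff_nhdsWithin_neBot.1 hmem
      have h1 : Filter.Tendsto (fun q : ℝ × ℝ × ℝ => |ψ q.1 q.2.1 i q.2.2|) (nhdsWithin q (domD T))
          (nhds |ψ q.1 q.2.1 i q.2.2|) := ((hψc i q hq).mono hsub).abs
      have h2 : Filter.Tendsto (fun q : ℝ × ℝ × ℝ => C * (1 + q.2.1)) (nhdsWithin q (domD T))
          (nhds (C * (1 + q.2.1))) := by
        have : Continuous fun q : ℝ × ℝ × ℝ => C * (1 + q.2.1) := by fun_prop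
        exact this.continuousWithinAt
      exact le_of_tendsto_of_tendsto h1 h2
        (eventually_nhdsWithin_of_forall fun q' hq' => hψb q'.1 q'.2.1 q'.2.2 hq' i)
    have hs0 : ∀ s : ℝ, 0 ≤ max s 0 := fun s => le_max_right _ _
    have hs1 : ∀ s : ℝ, 0 < 1 + max s 0 := fun s => by have := hs0 s; linarith
    have hmem : ∀ t s : ℝ, (clT T t, max s 0, (0 : ℝ)) ∈ domDbar T := fun t s =>
      ⟨hcl0 t, hclT t, hs0 s, le_rfl, hcl0 t⟩
    let w' : BoundedContinuousFunction (Fin k × ℝ × ℝ) ℝ :=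
      BoundedContinuousFunction.ofNormedAddCommGroup
        (fun x => ψ (clT T x.2.1) (max x.2.2 0) x.1 0 / (1 + max x.2.2 0))
        (by
          rw [continuous_prod_of_discrete_left]
          intro i
          refine Continuous.div ?_ (by fun_prop) fun q => (hs1 q.2).ne'
          exact (hψc i).comp_continuous (f := fun q : ℝ × ℝ => (clT T q.1, max q.2 0, (0 : ℝ)))
            (by unfold clT; fun_prop) (fun q => hmem q.1 q.2))
        C
        (by
          intro x
          rw [Real.norm_eq_abs, abs_div, abs_of_pos (hs1 _), div_le_iff₀ (hs1 _)]
          exact hψb' x.1 _ (hmem x.2.1 x.2.2))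
    have hw' : ∀ i t s, w' (i, t, s) = ψ (clT T t) (max s 0) i 0 / (1 + max s 0) :=
      fun _ _ _ => rfl
    have heq : ∀ i, Set.EqOn (fun q : ℝ × ℝ × ℝ => ψ q.1 q.2.1 i q.2.2)
        (fun q => RG r σ p (fun i y => f i (max y 0)) (fun i y => F i (max y 0)) K T w' i q.1 q.2.1 q.2.2)
        (domDbar T) := by
      intro i
      refine Set.EqOn.of_subset_closure (s := domD T) ?_ (hψc i)
        (RG_cont r σ p _ _ K T hK hg hp0 hp1 w' i).continuousOn hsub hcl'
      rintro ⟨t, s, y⟩ hq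
      obtain ⟨h1, h2, h3, h4, h5⟩ := id hq
      refine (hψe t s y hq i).trans ?_
      refine ie_eq r σ p K T f F hσ hK hp0 hp1 w' ψ ?_ t s y i h1.le h2.le h3 h4.le
      intro t x j ht0 ht hx
      rw [hw' j t x, hcl t ht0 ht, max_eq_left hx.le, abs_of_pos hx, div_mul_cancel₀]
      linarith
    have hww : w' = w := by
      refine huniq w' fun i t s => ?_
      rw [hw']
      congr 1
      exact heq i (hmem t s)
    intro t s y h i
    have := heq i h
    rw [hww] at this
    exact this
end

section
/- The unique non-negative continuous solution with at most linear growth of the Volterra integral equation φ(t,s,i,y) = ((1−F(T−t+y|i))/(1−F(y|i))) η_i(t,s) + ∫₀^{T−t} e^{−r(i)v} (f(y+v|i)/(1−F(y|i))) Σ_j p_{ij} ∫₀^∞ φ(t+v,x,j,0) α(x;s,i,v) dx dv, φ(t,0,i,y) = 0, is of class C^{1,2,1} on D; that is, on D it is continuously differentiable in t, twice continuously differentiable in s, and continuously differentiable in y. -/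
open MeasureTheory Real Set Finset

namespace VR
open ProbabilityTheory Filter Topology Function

/-- standard Gaussian -/
noncomputable abbrev gam : Measure ℝ := gaussianReal 0 1

/-- product of Lebesgue on `(0,T)` and the Gaussian -/
noncomputable abbrev mu (T : ℝ) : Measure (ℝ × ℝ) := (volume.restrict (Set.Ioo 0 T)).prod gam

structure GC (T : ℝ) (g : ℝ → ℝ → ℝ) : Prop where
  cont : ContinuousOn (uncurry g) (Set.Ioo 0 T ×ˢ Set.univ)
  zero : ∀ w, w ∉ Set.Ioo 0 T → ∀ x, g w x = 0
  bound : ∃ C, 0 ≤ C ∧ ∀ w x, |g w x| ≤ C * (1 + exp x)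

structure AC (T : ℝ) (A : ℝ → ℝ → ℝ → ℝ) : Prop where
  meas : ∀ y, Measurable (uncurry (A y))
  cont : ∀ v ∈ Set.Ioo 0 T, ∀ z, Continuous (fun y => A y v z)
  bound : ∀ y0, ∃ M, 0 ≤ M ∧ ∀ y ∈ Metric.ball y0 1, ∀ v ∈ Set.Ioo 0 T, ∀ z,
    |A y v z| ≤ M * (1 / √v * exp |z|)

noncomputable def J (m σ T : ℝ) (A : ℝ → ℝ → ℝ → ℝ) (g : ℝ → ℝ → ℝ) (t x y : ℝ) : ℝ :=
  ∫ q : ℝ × ℝ, A y q.1 q.2 * g (t + q.1) (x + m * q.1 + σ * √q.1 * q.2) ∂(mu T)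

lemma GC.meas {T : ℝ} {g : ℝ → ℝ → ℝ} (hg : GC T g) : Measurable (uncurry g) := by
  have hS : MeasurableSet ((Set.Ioo (0:ℝ) T) ×ˢ (Set.univ : Set ℝ)) :=
    measurableSet_Ioo.prod MeasurableSet.univ
  have h : uncurry g = Set.piecewise ((Set.Ioo (0:ℝ) T) ×ˢ (Set.univ : Set ℝ)) (uncurry g) (fun _ => 0) := by
    ext ⟨w, x⟩
    by_cases hw : w ∈ Set.Ioo 0 T
    · rw [Set.piecewise_eq_of_mem _ _ _ (by exact ⟨hw, trivial⟩)]
    · rw [Set.piecewise_eq_of_notMem _ _ _ (by rintro ⟨h1, -⟩; exact hw h1)]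
      exact hg.zero w hw x
  rw [h]
  classical
  have := hg.cont.measurable_piecewise (g := fun _ => (0:ℝ)) continuousOn_const hS
  convert this

lemma GC.slice_cont {T : ℝ} {g : ℝ → ℝ → ℝ} (hg : GC T g) (w : ℝ) : Continuous (g w) := by
  by_cases hw : w ∈ Set.Ioo 0 T
  · have : ContinuousOn (fun x : ℝ => uncurry g (w, x)) Set.univ :=
      hg.cont.comp (by fun_prop) (fun x _ => ⟨hw, trivial⟩)
    exact continuousOn_univ.1 this
  · have : g w = fun _ => 0 := funext fun x => hg.zero w hw x
    rw [this]; exact continuous_const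

lemma GC.contAt {T : ℝ} {g : ℝ → ℝ → ℝ} (hg : GC T g) (w x : ℝ) (h0 : w ≠ 0) (hT : w ≠ T) :
    ContinuousAt (uncurry g) (w, x) := by
  by_cases hw : w ∈ Set.Ioo 0 T
  · exact hg.cont.continuousAt ((isOpen_Ioo.prod isOpen_univ).mem_nhds ⟨hw, trivial⟩)
  · have hw2 : w ∈ (Set.Icc 0 T)ᶜ := by
      intro h
      exact hw ⟨lt_of_le_of_ne h.1 (Ne.symm h0), lt_of_le_of_ne h.2 hT⟩
    have : uncurry g =ᶠ[𝓝 (w, x)] fun _ => 0 := by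
      have h3 : ((Set.Icc (0:ℝ) T)ᶜ ×ˢ (Set.univ : Set ℝ)) ∈ 𝓝 (w, x) :=
        (isClosed_Icc.isOpen_compl.prod isOpen_univ).mem_nhds ⟨hw2, trivial⟩
      filter_upwards [h3] with q hq
      exact hg.zero q.1 (fun h => hq.1 ⟨h.1.le, h.2.le⟩) q.2
    exact continuousAt_const.congr this.symm

lemma integrable_exp_abs (c : ℝ) : Integrable (fun z : ℝ => exp (c * |z|)) gam := by
  have h1 : Integrable (fun z : ℝ => exp (c * z) + exp ((-c) * z)) gam :=
    (integrable_exp_mul_gaussianReal c).add (integrable_exp_mul_gaussianReal (-c))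
  refine h1.mono' (by fun_prop) (ae_of_all _ fun z => ?_)
  rw [Real.norm_eq_abs, abs_of_pos (exp_pos _)]
  rcases abs_cases z with ⟨h, -⟩ | ⟨h, -⟩ <;> rw [h]
  · linarith [exp_pos (-c * z)]
  · have : c * -z = -c * z := by ring
    rw [this]; linarith [exp_pos (c * z)]

lemma integrable_inv_sqrt (T : ℝ) : Integrable (fun v : ℝ => 1 / √v) (volume.restrict (Set.Ioo 0 T)) := by
  by_cases hT : 0 ≤ T
  · have := (intervalIntegral.intervalIntegrable_rpow' (a := 0) (b := T) (r := -(1/2)) (by norm_num))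
    rw [intervalIntegrable_iff_integrableOn_Ioo_of_le hT] at this
    refine (integrableOn_congr_fun ?_ measurableSet_Ioo).1 this
    intro v hv
    simp only
    rw [Real.rpow_neg hv.1.le, ← Real.sqrt_eq_rpow, one_div]
  · rw [Set.Ioo_eq_empty (fun h => hT h.le)]; simp

noncomputable def dom (c : ℝ) (q : ℝ × ℝ) : ℝ := 1 / √q.1 * exp (c * |q.2|)

lemma integrable_dom (T c : ℝ) : Integrable (dom c) (mu T) :=
  (integrable_inv_sqrt T).mul_prod (integrable_exp_abs c)

lemma g_bound {T m σ C : ℝ} (hσ : 0 ≤ σ) {g : ℝ → ℝ → ℝ} (hC : 0 ≤ C)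
    (hg : ∀ w x, |g w x| ≤ C * (1 + exp x)) (w x v z : ℝ) (hv : v ∈ Set.Icc 0 T) :
    |g w (x + m * v + σ * √v * z)| ≤ C * exp (|m| * T) * (1 + exp x) * exp ((σ * √T) * |z|) := by
  refine (hg _ _).trans ?_
  have h1 : m * v ≤ |m| * T := by
    calc m * v ≤ |m| * v := by gcongr; exacts [hv.1, le_abs_self m]
      _ ≤ _ := by gcongr; exact hv.2
  have h2 : σ * √v * z ≤ σ * √T * |z| := by
    calc σ * √v * z ≤ σ * √v * |z| := by gcongr; exact le_abs_self z
      _ ≤ _ := by gcongr; exact hv.2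
  have hT : 0 ≤ T := hv.1.trans hv.2
  have h3 : exp (x + m * v + σ * √v * z) ≤ exp x * (exp (|m| * T) * exp ((σ * √T) * |z|)) := by
    rw [← exp_add, ← exp_add]; apply exp_le_exp.2; linarith
  have h4 : 1 ≤ exp (|m| * T) * exp ((σ * √T) * |z|) := by
    rw [← exp_add]; apply one_le_exp; positivity
  calc C * (1 + exp (x + m * v + σ * √v * z))
      ≤ C * (exp (|m| * T) * exp ((σ * √T) * |z|) + exp x * (exp (|m| * T) * exp ((σ * √T) * |z|))) := by
        gcongr
    _ = _ := by ring

lemma ae_mu_mem (T : ℝ) : ∀ᵐ q ∂(mu T), q.1 ∈ Set.Ioo 0 T := by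
  have : ∀ᵐ v ∂(volume.restrict (Set.Ioo (0:ℝ) T)), v ∈ Set.Ioo 0 T := ae_restrict_mem measurableSet_Ioo
  exact Measure.quasiMeasurePreserving_fst.ae this

lemma ae_mu_ne (T a : ℝ) : ∀ᵐ q ∂(mu T), q.1 ≠ a := by
  have : ∀ᵐ v ∂(volume.restrict (Set.Ioo (0:ℝ) T)), v ≠ a :=
    ae_restrict_of_ae (by simp [ae_iff, measure_singleton])
  exact Measure.quasiMeasurePreserving_fst.ae this

/-- pointwise domination of the integrand -/
lemma Ag_bound {T m σ C M : ℝ} (hσ : 0 ≤ σ) {g : ℝ → ℝ → ℝ} (hC : 0 ≤ C) (hM : 0 ≤ M)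
    (hg : ∀ w x, |g w x| ≤ C * (1 + exp x)) {a : ℝ} (w x v z : ℝ) (hv : v ∈ Set.Ioo 0 T)
    (ha : |a| ≤ M * (1 / √v * exp |z|)) :
    |a * g w (x + m * v + σ * √v * z)| ≤
      (M * C * exp (|m| * T)) * (1 + exp x) * dom (1 + σ * √T) (v, z) := by
  rw [abs_mul]
  have h := g_bound (m := m) hσ hC hg w x v z ⟨hv.1.le, hv.2.le⟩
  calc _ ≤ (M * (1 / √v * exp |z|)) * (C * exp (|m| * T) * (1 + exp x) * exp ((σ * √T) * |z|)) := by
        gcongr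
    _ = (M * C * exp (|m| * T)) * (1 + exp x) * (1 / √v * (exp |z| * exp ((σ * √T) * |z|))) := by ring
    _ = _ := by rw [← exp_add]; simp only [dom]; congr 3; ring_nf

lemma Ag_meas {T m σ : ℝ} {g : ℝ → ℝ → ℝ} (hg : GC T g) {a : ℝ → ℝ → ℝ} (ha : Measurable (uncurry a))
    (t x : ℝ) :
    Measurable (fun q : ℝ × ℝ => a q.1 q.2 * g (t + q.1) (x + m * q.1 + σ * √q.1 * q.2)) := by
  have h1 : Measurable (fun q : ℝ × ℝ => uncurry g (t + q.1, x + m * q.1 + σ * √q.1 * q.2)) :=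
    hg.meas.comp (by fun_prop)
  exact ha.mul h1

lemma Ag_integrable {T m σ : ℝ} (hσ : 0 ≤ σ) {g : ℝ → ℝ → ℝ} (hg : GC T g)
    {A : ℝ → ℝ → ℝ → ℝ} (hA : AC T A) (t x y : ℝ) :
    Integrable (fun q : ℝ × ℝ => A y q.1 q.2 * g (t + q.1) (x + m * q.1 + σ * √q.1 * q.2)) (mu T) := by
  obtain ⟨C, hC, hgb⟩ := hg.bound
  obtain ⟨M, hM, hAb⟩ := hA.bound y
  refine ((integrable_dom T (1 + σ * √T)).const_mul ((M * C * exp (|m| * T)) * (1 + exp x))).mono'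
    (Ag_meas hg (hA.meas y) t x).aestronglyMeasurable ?_
  filter_upwards [ae_mu_mem T] with q hq
  exact Ag_bound hσ hC hM hgb _ _ _ _ hq (hAb y (Metric.mem_ball_self one_pos) _ hq _)

lemma J_bound {T m σ : ℝ} (hσ : 0 ≤ σ) {g : ℝ → ℝ → ℝ} (hg : GC T g)
    {A : ℝ → ℝ → ℝ → ℝ} (hA : AC T A) (y : ℝ) :
    ∃ B, 0 ≤ B ∧ ∀ t x, |J m σ T A g t x y| ≤ B * (1 + exp x) := by
  obtain ⟨C, hC, hgb⟩ := hg.bound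
  obtain ⟨M, hM, hAb⟩ := hA.bound y
  refine ⟨(M * C * exp (|m| * T)) * ∫ q, dom (1 + σ * √T) q ∂(mu T), ?_, fun t x => ?_⟩
  · have : 0 ≤ ∫ q, dom (1 + σ * √T) q ∂(mu T) := integral_nonneg fun q => by
      simp only [dom, Pi.zero_apply]; positivity
    positivity
  · have h := norm_integral_le_of_norm_le
      (((integrable_dom T (1 + σ * √T)).const_mul ((M * C * exp (|m| * T)) * (1 + exp x))))
      (f := fun q : ℝ × ℝ => A y q.1 q.2 * g (t + q.1) (x + m * q.1 + σ * √q.1 * q.2)) (by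
        filter_upwards [ae_mu_mem T] with q hq
        exact Ag_bound hσ hC hM hgb _ _ _ _ hq (hAb y (Metric.mem_ball_self one_pos) _ hq _))
    rw [integral_const_mul] at h
    rw [← Real.norm_eq_abs]
    refine h.trans (le_of_eq (by ring))

lemma J_cont {T m σ : ℝ} (hσ : 0 ≤ σ) {g : ℝ → ℝ → ℝ} (hg : GC T g)
    {A : ℝ → ℝ → ℝ → ℝ} (hA : AC T A) :
    Continuous (fun p : ℝ × ℝ × ℝ => J m σ T A g p.1 p.2.1 p.2.2) := by
  rw [continuous_iff_continuousAt]
  rintro ⟨t0, x0, y0⟩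
  obtain ⟨C, hC, hgb⟩ := hg.bound
  obtain ⟨M, hM, hAb⟩ := hA.bound y0
  refine continuousAt_of_dominated (bound := fun q => ((M * C * exp (|m| * T)) * (1 + exp (x0 + 1))) * dom (1 + σ * √T) q)
    (Eventually.of_forall fun p => (Ag_meas hg (hA.meas p.2.2) p.1 p.2.1).aestronglyMeasurable) ?_
    ((integrable_dom T (1 + σ * √T)).const_mul _) ?_
  · have h1 : ∀ᶠ p : ℝ × ℝ × ℝ in 𝓝 (t0, x0, y0), p.2.2 ∈ Metric.ball y0 1 :=
      (continuous_snd.snd.tendsto (t0, x0, y0)).eventually (Metric.ball_mem_nhds y0 one_pos)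
    have h2 : ∀ᶠ p : ℝ × ℝ × ℝ in 𝓝 (t0, x0, y0), p.2.1 < x0 + 1 :=
      (continuous_snd.fst.tendsto (t0, x0, y0)).eventually (gt_mem_nhds (by simp))
    filter_upwards [h1, h2] with p hp1 hp2
    filter_upwards [ae_mu_mem T] with q hq
    refine (Ag_bound hσ hC hM hgb _ _ _ _ hq (hAb _ hp1 _ hq _)).trans ?_
    have : 0 ≤ dom (1 + σ * √T) q := by simp only [dom]; positivity
    gcongr
  · filter_upwards [ae_mu_mem T, ae_mu_ne T (-t0), ae_mu_ne T (T - t0)] with q hq hq1 hq2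
    have hc := hg.contAt (t0 + q.1) (x0 + m * q.1 + σ * √q.1 * q.2) (fun h => hq1 (by linarith))
      (fun h => hq2 (by linarith))
    have h1 : ContinuousAt (fun p : ℝ × ℝ × ℝ => uncurry g (p.1 + q.1, p.2.1 + m * q.1 + σ * √q.1 * q.2)) (t0, x0, y0) := by
      exact ContinuousAt.comp (g := uncurry g) (x := (t0, x0, y0))
        (f := fun p : ℝ × ℝ × ℝ => (p.1 + q.1, p.2.1 + m * q.1 + σ * √q.1 * q.2)) hc (by fun_prop)
    exact (((hA.cont q.1 hq q.2).comp continuous_snd.snd).continuousAt).mul h1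

lemma J_dy {T m σ : ℝ} (hσ : 0 ≤ σ) {g : ℝ → ℝ → ℝ} (hg : GC T g)
    {A A' : ℝ → ℝ → ℝ → ℝ} (hA : AC T A) (hA' : AC T A')
    (hd : ∀ y, ∀ v ∈ Set.Ioo 0 T, ∀ z, HasDerivAt (fun y => A y v z) (A' y v z) y) (t x y : ℝ) :
    HasDerivAt (fun y => J m σ T A g t x y) (J m σ T A' g t x y) y := by
  obtain ⟨C, hC, hgb⟩ := hg.bound
  obtain ⟨M, hM, hAb⟩ := hA'.bound y
  refine (hasDerivAt_integral_of_dominated_loc_of_deriv_le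
    (bound := fun q => ((M * C * exp (|m| * T)) * (1 + exp x)) * dom (1 + σ * √T) q)
    (F' := fun y q => A' y q.1 q.2 * g (t + q.1) (x + m * q.1 + σ * √q.1 * q.2))
    (Metric.ball_mem_nhds y one_pos)
    (Eventually.of_forall fun p => (Ag_meas hg (hA.meas p) _ _).aestronglyMeasurable)
    (Ag_integrable hσ hg hA t x y) (Ag_meas hg (hA'.meas y) _ _).aestronglyMeasurable
    ?_ ((integrable_dom T (1 + σ * √T)).const_mul _) ?_).2
  · filter_upwards [ae_mu_mem T] with q hq y' hy'
    exact (Ag_bound hσ hC hM hgb _ _ _ _ hq (hAb _ hy' _ hq _))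
  · filter_upwards [ae_mu_mem T] with q hq y' hy'
    exact (hd y' q.1 hq q.2).mul_const _

lemma J_dx_easy {T m σ : ℝ} (hσ : 0 ≤ σ) {g g' : ℝ → ℝ → ℝ} (hg : GC T g) (hg' : GC T g')
    (hd : ∀ w x, HasDerivAt (g w) (g' w x) x)
    {A : ℝ → ℝ → ℝ → ℝ} (hA : AC T A) (t x y : ℝ) :
    HasDerivAt (fun x => J m σ T A g t x y) (J m σ T A g' t x y) x := by
  obtain ⟨C, hC, hgb⟩ := hg'.bound
  obtain ⟨M, hM, hAb⟩ := hA.bound y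
  refine (hasDerivAt_integral_of_dominated_loc_of_deriv_le
    (bound := fun q => ((M * C * exp (|m| * T)) * (1 + exp (x + 1))) * dom (1 + σ * √T) q)
    (F := fun x q => A y q.1 q.2 * g (t + q.1) (x + m * q.1 + σ * √q.1 * q.2))
    (F' := fun x q => A y q.1 q.2 * g' (t + q.1) (x + m * q.1 + σ * √q.1 * q.2))
    (Metric.ball_mem_nhds x one_pos)
    (Eventually.of_forall fun p => (Ag_meas hg (hA.meas y) _ _).aestronglyMeasurable)
    (Ag_integrable hσ hg hA t x y) (Ag_meas hg' (hA.meas y) _ _).aestronglyMeasurable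
    ?_ ((integrable_dom T (1 + σ * √T)).const_mul _) ?_).2
  · filter_upwards [ae_mu_mem T] with q hq x' hx'
    refine (Ag_bound hσ hC hM hgb _ _ _ _ hq (hAb _ (Metric.mem_ball_self one_pos) _ hq _)).trans ?_
    have : 0 ≤ dom (1 + σ * √T) q := by simp only [dom]; positivity
    have hx2 : x' ≤ x + 1 := by
      rw [Metric.mem_ball, Real.dist_eq] at hx'
      linarith [(abs_lt.1 hx').2]
    gcongr
  · filter_upwards [ae_mu_mem T] with q hq x' hx'
    have h1 : HasDerivAt (fun x : ℝ => x + m * q.1 + σ * √q.1 * q.2) 1 x' := by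
      simpa using ((hasDerivAt_id x').add_const (m * q.1)).add_const (σ * √q.1 * q.2)
    have h2 := (hd (t + q.1) (x' + m * q.1 + σ * √q.1 * q.2)).comp x' h1
    simpa using h2.const_mul (A y q.1 q.2)
end VR

namespace VR
open ProbabilityTheory Filter Topology Function

lemma gauss_shift (G : ℝ → ℝ) (h : ℝ) :
    ∫ z, G (z + h) ∂gam = ∫ z, G z * exp (h * z - h ^ 2 / 2) ∂gam := by
  rw [integral_gaussianReal_eq_integral_smul one_ne_zero,
    integral_gaussianReal_eq_integral_smul one_ne_zero]
  refine Eq.trans ?_ (integral_add_right_eq_self (μ := (volume : Measure ℝ))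
    (fun z => gaussianPDFReal 0 1 z • (G z * exp (h * z - h ^ 2 / 2))) h)
  refine integral_congr_ae (ae_of_all _ fun z => ?_)
  simp only [gaussianPDFReal, smul_eq_mul]
  have : exp (-(z - 0) ^ 2 / (2 * ((1 : NNReal) : ℝ))) =
      exp (-(z + h - 0) ^ 2 / (2 * ((1 : NNReal) : ℝ))) * exp (h * (z + h) - h ^ 2 / 2) := by
    rw [← exp_add]; congr 1; push_cast; ring
  rw [this]; ring

lemma dx0 {G : ℝ → ℝ} (hG : Continuous G) {C τ : ℝ} (hC : 0 ≤ C) (hτ : 0 < τ)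
    (hb : ∀ x, |G x| ≤ C * (1 + exp x)) (x : ℝ) :
    HasDerivAt (fun x => ∫ z, G (x + τ * z) ∂gam) (∫ z, z / τ * G (x + τ * z) ∂gam) x := by
  have key : ∀ x, ∫ z, G (x + τ * z) ∂gam
      = ∫ z, G (τ * z) * exp ((x / τ) * z - (x / τ) ^ 2 / 2) ∂gam := by
    intro x
    rw [← gauss_shift (fun z => G (τ * z)) (x / τ)]
    congr 1; ext z; congr 1; field_simp; ring
  have hb1 : ∀ z, |G (τ * z)| ≤ 2 * C * exp (τ * |z|) := by
    intro z
    refine (hb _).trans ?_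
    have h1 : exp (τ * z) ≤ exp (τ * |z|) := by
      apply exp_le_exp.2; gcongr; exact le_abs_self z
    have h2 : 1 ≤ exp (τ * |z|) := one_le_exp (by positivity)
    nlinarith
  have hb2 : ∀ h0 h z : ℝ, h ∈ Metric.ball h0 1 → exp (h * z - h ^ 2 / 2) ≤ exp ((|h0| + 1) * |z|) := by
    intro h0 h z hh
    rw [Metric.mem_ball, Real.dist_eq] at hh
    apply exp_le_exp.2
    have h3 : |h| ≤ |h0| + 1 := by
      have := abs_sub_abs_le_abs_sub h h0; linarith
    have h4 : h * z ≤ |h| * |z| := by rw [← abs_mul]; exact le_abs_self _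
    nlinarith [abs_nonneg z, sq_nonneg h]
  set h0 := x / τ with hh0
  have hmeas : ∀ h : ℝ, Continuous (fun z => G (τ * z) * exp (h * z - h ^ 2 / 2)) := by
    intro h; fun_prop
  have hder := (hasDerivAt_integral_of_dominated_loc_of_deriv_le (μ := gam)
    (F := fun h z => G (τ * z) * exp (h * z - h ^ 2 / 2))
    (F' := fun h z => G (τ * z) * (exp (h * z - h ^ 2 / 2) * (z - h)))
    (bound := fun z => (2 * C * exp (|h0| + 1)) * exp ((τ + (|h0| + 1) + 1) * |z|))
    (Metric.ball_mem_nhds h0 one_pos)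
    (Eventually.of_forall fun h => (hmeas h).aestronglyMeasurable)
    ?_ (by fun_prop) ?_ ((integrable_exp_abs _).const_mul _) ?_).2
  · have hcomp : HasDerivAt (fun x : ℝ => x / τ) (1 / τ) x := (hasDerivAt_id x).div_const τ
    have h5 := HasDerivAt.comp x (hh0 ▸ hder) hcomp
    have h6 : (fun x => ∫ z, G (x + τ * z) ∂gam) =
      (fun h => ∫ z, G (τ * z) * exp (h * z - h ^ 2 / 2) ∂gam) ∘ (fun x => x / τ) := by
      ext x; exact key x
    rw [h6]
    refine h5.congr_deriv ?_
    rw [← hh0]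
    have h7 := gauss_shift (fun z => (z - h0) / τ * G (τ * z)) h0
    have h8 : ∫ z, z / τ * G (x + τ * z) ∂gam = ∫ z, (z + h0 - h0) / τ * G (τ * (z + h0)) ∂gam := by
      congr 1; ext z; rw [add_sub_cancel_right]; congr 2; rw [hh0]; field_simp; ring
    rw [h8, h7, ← integral_mul_const]
    congr 1; ext z; ring
  · refine ((integrable_exp_abs (τ + (|h0| + 1))).const_mul (2 * C)).mono'
      (hmeas h0).aestronglyMeasurable (ae_of_all _ fun z => ?_)
    rw [norm_mul, Real.norm_eq_abs, Real.norm_eq_abs, abs_of_pos (exp_pos _)]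
    calc _ ≤ (2 * C * exp (τ * |z|)) * exp ((|h0| + 1) * |z|) := by
          exact mul_le_mul (hb1 z) (hb2 h0 h0 z (Metric.mem_ball_self one_pos)) (exp_pos _).le (by positivity)
      _ = _ := by rw [mul_assoc, ← exp_add]; congr 2; ring
  · refine ae_of_all _ fun z h hh => ?_
    rw [norm_mul, norm_mul, Real.norm_eq_abs, Real.norm_eq_abs, Real.norm_eq_abs, abs_of_pos (exp_pos _)]
    have h9 : |z - h| ≤ exp (|z| + (|h0| + 1)) := by
      have hh' := hh
      rw [Metric.mem_ball, Real.dist_eq] at hh'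
      have h3 : |h| ≤ |h0| + 1 := by
        have := abs_sub_abs_le_abs_sub h h0; linarith
      have h4 := abs_sub z h
      have h5 := add_one_le_exp (|z| + (|h0| + 1))
      linarith
    calc _ ≤ (2 * C * exp (τ * |z|)) * (exp ((|h0| + 1) * |z|) * exp (|z| + (|h0| + 1))) := by
          exact mul_le_mul (hb1 z) (mul_le_mul (hb2 h0 h z hh) h9 (abs_nonneg _) (exp_pos _).le)
            (by positivity) (by positivity)
      _ = 2 * C * (exp (τ * |z|) * (exp ((|h0| + 1) * |z|) * exp (|z| + (|h0| + 1)))) := by ring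
      _ = _ := by
          rw [← exp_add, ← exp_add, mul_assoc (2 * C) (exp _) (exp _), ← exp_add]; congr 2; ring
  · refine ae_of_all _ fun z h hh => ?_
    have h1 : HasDerivAt (fun h : ℝ => h * z - h ^ 2 / 2) (z - h) h := by
      have := ((hasDerivAt_id h).mul_const z).sub ((hasDerivAt_pow 2 h).div_const 2)
      refine this.congr_deriv ?_; simp
    exact h1.exp.const_mul _

lemma J_eq {T m σ : ℝ} (hσ : 0 ≤ σ) {g : ℝ → ℝ → ℝ} (hg : GC T g)
    {A : ℝ → ℝ → ℝ → ℝ} (hA : AC T A) (t x y : ℝ) :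
    J m σ T A g t x y = ∫ v in Set.Ioo 0 T,
      ∫ z, A y v z * g (t + v) (x + m * v + σ * √v * z) ∂gam :=
  integral_prod _ (Ag_integrable hσ hg hA t x y)

/-- bound on the inner integral -/
lemma inner_bound {T m σ : ℝ} (hσ : 0 ≤ σ) {g : ℝ → ℝ → ℝ} (hg : GC T g)
    {A : ℝ → ℝ → ℝ → ℝ} (hA : AC T A) (y : ℝ) : ∃ B, 0 ≤ B ∧
    ∀ w x, ∀ v ∈ Set.Ioo 0 T, |∫ z, A y v z * g w (x + m * v + σ * √v * z) ∂gam| ≤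
      B * (1 + exp x) * (1 / √v) := by
  obtain ⟨C, hC, hgb⟩ := hg.bound
  obtain ⟨M, hM, hAb⟩ := hA.bound y
  refine ⟨(M * C * exp (|m| * T)) * ∫ z, exp ((1 + σ * √T) * |z|) ∂gam, ?_, fun w x v hv => ?_⟩
  · have : 0 ≤ ∫ z, exp ((1 + σ * √T) * |z|) ∂gam := integral_nonneg fun q => (exp_pos _).le
    positivity
  · have h := norm_integral_le_of_norm_le
      (((integrable_exp_abs (1 + σ * √T)).const_mul ((M * C * exp (|m| * T)) * (1 + exp x) * (1 / √v))))
      (f := fun z : ℝ => A y v z * g w (x + m * v + σ * √v * z)) (by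
        refine ae_of_all _ fun z => ?_
        refine (Ag_bound hσ hC hM hgb _ _ _ _ hv (hAb y (Metric.mem_ball_self one_pos) _ hv z)).trans (le_of_eq ?_)
        simp only [dom]; ring)
    rw [integral_const_mul] at h
    rw [← Real.norm_eq_abs]
    refine h.trans (le_of_eq (by ring))

lemma J_dx_kernel {T m σ : ℝ} (hσ : 0 < σ) {g : ℝ → ℝ → ℝ} (hg : GC T g) {a : ℝ → ℝ → ℝ}
    (hA : AC T (fun y v _ => a y v)) (hA' : AC T (fun y v z => a y v * (z / (σ * √v)))) (t x y : ℝ) :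
    HasDerivAt (fun x => J m σ T (fun y v _ => a y v) g t x y)
      (J m σ T (fun y v z => a y v * (z / (σ * √v))) g t x y) x := by
  obtain ⟨C, hC, hgb⟩ := hg.bound
  obtain ⟨B, hB, hBb⟩ := inner_bound (m := m) hσ.le hg hA' y
  have h1 : (fun x => J m σ T (fun y v _ => a y v) g t x y) = fun x => ∫ v in Set.Ioo 0 T,
      ∫ z, a y v * g (t + v) (x + m * v + σ * √v * z) ∂gam := by
    ext x; exact J_eq hσ.le hg hA t x y
  rw [h1, J_eq hσ.le hg hA' t x y]
  refine (hasDerivAt_integral_of_dominated_loc_of_deriv_le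
    (F := fun x v => ∫ z, a y v * g (t + v) (x + m * v + σ * √v * z) ∂gam)
    (F' := fun x v => ∫ z, a y v * (z / (σ * √v)) * g (t + v) (x + m * v + σ * √v * z) ∂gam)
    (bound := fun v => B * (1 + exp (x + 1)) * (1 / √v))
    (Metric.ball_mem_nhds x one_pos)
    (Eventually.of_forall fun x => (Ag_integrable hσ.le hg hA t x y).integral_prod_left.aestronglyMeasurable)
    (Ag_integrable hσ.le hg hA t x y).integral_prod_left
    (Ag_integrable hσ.le hg hA' t x y).integral_prod_left.aestronglyMeasurable
    ?_ ((integrable_inv_sqrt T).const_mul _) ?_).2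
  · filter_upwards [ae_restrict_mem measurableSet_Ioo] with v hv x' hx'
    refine (hBb (t + v) x' v hv).trans ?_
    have hx2 : x' ≤ x + 1 := by
      rw [Metric.mem_ball, Real.dist_eq] at hx'
      linarith [(abs_lt.1 hx').2]
    gcongr
  · filter_upwards [ae_restrict_mem measurableSet_Ioo] with v hv x' hx'
    have hτ : 0 < σ * √v := mul_pos hσ (Real.sqrt_pos.2 hv.1)
    have h2 := dx0 (hg.slice_cont (t + v)) hC hτ (hgb (t + v)) (x' + m * v)
    have h3 := (h2.comp_add_const x' (m * v)).const_mul (a y v)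
    rw [← integral_const_mul] at h3
    simp_rw [← integral_const_mul] at h3
    refine h3.congr_deriv ?_
    congr 1; ext z; ring
end VR

namespace VR
open ProbabilityTheory Filter Topology Function

lemma slice_meas {T : ℝ} {g : ℝ → ℝ → ℝ} (hg : GC T g) {A : ℝ → ℝ → ℝ} (hA : Measurable (uncurry A))
    (m σ x w v : ℝ) : Measurable (fun z => A v z * g w (x + m * v + σ * √v * z)) := by
  have h1 : Measurable (fun z : ℝ => uncurry A (v, z)) := hA.comp (by fun_prop)
  have h2 : Measurable (fun z : ℝ => g w (x + m * v + σ * √v * z)) :=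
    (hg.slice_cont w).measurable.comp (by fun_prop)
  exact h1.mul h2

lemma slice_int {T m σ : ℝ} (hσ : 0 ≤ σ) {g : ℝ → ℝ → ℝ} (hg : GC T g)
    {A : ℝ → ℝ → ℝ → ℝ} (hA : AC T A) (y x w v : ℝ) (hv : v ∈ Set.Ioo 0 T) :
    Integrable (fun z => A y v z * g w (x + m * v + σ * √v * z)) gam := by
  obtain ⟨C, hC, hgb⟩ := hg.bound
  obtain ⟨M, hM, hAb⟩ := hA.bound y
  refine ((integrable_exp_abs (1 + σ * √T)).const_mul
    ((M * C * exp (|m| * T)) * (1 + exp x) * (1 / √v))).mono'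
    (slice_meas hg (hA.meas y) m σ x w v).aestronglyMeasurable (ae_of_all _ fun z => ?_)
  refine (Ag_bound hσ hC hM hgb _ _ _ _ hv (hAb y (Metric.mem_ball_self one_pos) _ hv z)).trans (le_of_eq ?_)
  simp only [dom]; ring

noncomputable def Kin (m σ : ℝ) (A : ℝ → ℝ → ℝ) (g : ℝ → ℝ → ℝ) (x w v : ℝ) : ℝ :=
  ∫ z, A v z * g w (x + m * v + σ * √v * z) ∂gam

lemma Kin_meas {T m σ : ℝ} {g : ℝ → ℝ → ℝ} (hg : GC T g) {A : ℝ → ℝ → ℝ} (hA : Measurable (uncurry A))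
    (x : ℝ) : Measurable (fun p : ℝ × ℝ => Kin m σ A g x p.1 p.2) := by
  have h1 : Measurable (fun q : (ℝ × ℝ) × ℝ => A q.1.2 q.2 * g q.1.1 (x + m * q.1.2 + σ * √q.1.2 * q.2)) := by
    have h2 : Measurable (fun q : (ℝ × ℝ) × ℝ => uncurry A (q.1.2, q.2)) := hA.comp (by fun_prop)
    have h3 : Measurable (fun q : (ℝ × ℝ) × ℝ => uncurry g (q.1.1, x + m * q.1.2 + σ * √q.1.2 * q.2)) :=
      hg.meas.comp (by fun_prop)
    exact h2.mul h3
  exact (h1.stronglyMeasurable.integral_prod_right' (ν := gam)).measurable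

lemma Kin_zero {T m σ : ℝ} {g : ℝ → ℝ → ℝ} (hg : GC T g) {A : ℝ → ℝ → ℝ} (x w v : ℝ)
    (hw : w ∉ Set.Ioo 0 T) : Kin m σ A g x w v = 0 := by
  simp [Kin, hg.zero w hw]

/-- `v`-derivative of inner integral -/
lemma Kin_deriv {T m σ : ℝ} (hσ : 0 ≤ σ) {g g' : ℝ → ℝ → ℝ} (hg : GC T g) (hg' : GC T g')
    (hd : ∀ w x, HasDerivAt (g w) (g' w x) x) {a av : ℝ → ℝ → ℝ}
    (hav : ∀ y v, HasDerivAt (a y) (av y v) v)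
    (hA : AC T (fun y v _ => a y v)) (hAv : AC T (fun y v _ => av y v))
    (hAm : AC T (fun y v z => a y v * (m + σ * z / (2 * √v)))) (x y w v : ℝ) (hv : v ∈ Set.Ioo 0 T) :
    HasDerivAt (Kin m σ (fun v _ => a y v) g x w)
      (Kin m σ (fun v _ => av y v) g x w v + Kin m σ (fun v z => a y v * (m + σ * z / (2 * √v))) g' x w v) v := by
  obtain ⟨C, hC, hgb⟩ := hg.bound
  obtain ⟨C', hC', hgb'⟩ := hg'.bound
  obtain ⟨M, hM, hAb⟩ := hAv.bound y
  obtain ⟨M', hM', hAb'⟩ := hAm.bound y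
  have hv0 := hv.1
  have := (hasDerivAt_integral_of_dominated_loc_of_deriv_le (μ := gam)
    (F := fun v z => a y v * g w (x + m * v + σ * √v * z))
    (F' := fun v z => av y v * g w (x + m * v + σ * √v * z)
      + (a y v * (m + σ * z / (2 * √v))) * g' w (x + m * v + σ * √v * z))
    (bound := fun z => ((M * C * exp (|m| * T)) * (1 + exp x) * (1 / √(v / 2))
      + (M' * C' * exp (|m| * T)) * (1 + exp x) * (1 / √(v / 2))) * exp ((1 + σ * √T) * |z|))
    (Ioo_mem_nhds (show v / 2 < v by linarith) hv.2)
    (Eventually.of_forall fun v => (slice_meas hg (hA.meas y) m σ x w v).aestronglyMeasurable)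
    (slice_int hσ hg hA y x w v hv)
    ((slice_meas hg (hAv.meas y) m σ x w v).add (slice_meas hg' (hAm.meas y) m σ x w v)).aestronglyMeasurable
    ?_ ((integrable_exp_abs _).const_mul _) ?_).2
  · rw [Kin, Kin, ← integral_add (slice_int hσ hg hAv y x w v hv) (slice_int hσ hg' hAm y x w v hv)]
    exact this
  · refine ae_of_all _ fun z v' hv' => ?_
    have hv'' : v' ∈ Set.Ioo 0 T := ⟨by linarith [hv'.1], hv'.2⟩
    have e1 := Ag_bound (m := m) hσ hC hM hgb w x _ _ hv'' (hAb y (Metric.mem_ball_self one_pos) _ hv'' z)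
    have e2 := Ag_bound (m := m) hσ hC' hM' hgb' w x _ _ hv'' (hAb' y (Metric.mem_ball_self one_pos) _ hv'' z)
    have e3 : 1 / √v' ≤ 1 / √(v / 2) := by
      apply one_div_le_one_div_of_le (Real.sqrt_pos.2 (by linarith)) (Real.sqrt_le_sqrt hv'.1.le)
    have e4 : dom (1 + σ * √T) (v', z) ≤ (1 / √(v / 2)) * exp ((1 + σ * √T) * |z|) := by
      simp only [dom]; gcongr
    refine (norm_add_le _ _).trans ?_
    rw [add_mul]
    refine add_le_add (e1.trans ?_) (e2.trans ?_)
    · rw [mul_assoc _ (1 / √(v / 2))]; gcongr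
    · rw [mul_assoc _ (1 / √(v / 2))]; gcongr
  · refine ae_of_all _ fun z v' hv' => ?_
    have hv'' : v' ∈ Set.Ioo 0 T := ⟨by linarith [hv'.1], hv'.2⟩
    have h1 : HasDerivAt (fun v : ℝ => x + m * v + σ * √v * z) (m + σ * z / (2 * √v')) v' := by
      have := (((hasDerivAt_id v').const_mul m).const_add x).add
        (((Real.hasDerivAt_sqrt hv''.1.ne').const_mul σ).mul_const z)
      refine this.congr_deriv ?_
      simp; ring
    have h2 := (hd w (x + m * v' + σ * √v' * z)).comp v' h1
    refine ((hav y v').mul h2).congr_deriv ?_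
    simp only [Function.comp]; ring

lemma Kin_cont {T m σ : ℝ} (hσ : 0 ≤ σ) {g : ℝ → ℝ → ℝ} (hg : GC T g) {a : ℝ → ℝ}
    (ha : Continuous a) (x w : ℝ) : ContinuousOn (Kin m σ (fun v _ => a v) g x w) (Set.Icc 0 T) := by
  obtain ⟨C, hC, hgb⟩ := hg.bound
  obtain ⟨N, hN⟩ := (isCompact_Icc (a := (0:ℝ)) (b := T)).exists_bound_of_continuousOn ha.continuousOn
  refine continuousOn_of_dominated
    (bound := fun z => N * (C * exp (|m| * T) * (1 + exp x)) * exp ((σ * √T) * |z|))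
    (fun v _ => (slice_meas hg (A := fun v _ => a v) (ha.measurable.comp measurable_fst) m σ x w v).aestronglyMeasurable) ?_
    ((integrable_exp_abs _).const_mul _) ?_
  · refine fun v hv => ae_of_all _ fun z => ?_
    rw [norm_mul, mul_assoc N]
    have := g_bound (m := m) hσ hC hgb w x v z hv
    have h2 := hN v hv
    exact mul_le_mul h2 this (norm_nonneg _) ((norm_nonneg _).trans h2)
  · refine ae_of_all _ fun z => Continuous.continuousOn ?_
    have := hg.slice_cont w
    fun_prop

lemma Kin_at_zero (m σ : ℝ) (g : ℝ → ℝ → ℝ) (a : ℝ → ℝ) (x w : ℝ) :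
    Kin m σ (fun v _ => a v) g x w 0 = a 0 * g w x := by
  simp [Kin]

/-- triangle Fubini -/
lemma tri {T t B : ℝ} (ht : 0 < t) (κ : ℝ → ℝ → ℝ)
    (hm : Measurable (fun p : ℝ × ℝ => κ p.1 p.2))
    (hz : ∀ w v, T ≤ w → κ w v = 0)
    (hb : ∀ w, ∀ v ∈ Set.Ioo 0 T, |κ w v| ≤ B * (1 / √v)) :
    Integrable (fun w => ∫ v in Set.Ioo 0 (w - t), κ w v) (volume.restrict (Set.Ioo t T)) ∧
    ∫ w in Set.Ioo t T, ∫ v in Set.Ioo 0 (w - t), κ w v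
      = ∫ τ in Set.Ioo t T, ∫ v in Set.Ioo 0 T, κ (τ + v) v := by
  set mw := volume.restrict (Set.Ioo t T) with hmw
  set mv := volume.restrict (Set.Ioo 0 T) with hmv
  have hbint : Integrable (fun p : ℝ × ℝ => (fun _ => B) p.1 * (fun v => 1 / √v) p.2) (mw.prod mv) :=
    (integrable_const B).mul_prod (integrable_inv_sqrt T)
  have hmem : ∀ᵐ p ∂(mw.prod mv), p.2 ∈ Set.Ioo 0 T :=
    Measure.quasiMeasurePreserving_snd.ae (ae_restrict_mem measurableSet_Ioo)
  set S : Set (ℝ × ℝ) := {p | p.2 < p.1 - t} with hS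
  have hSm : MeasurableSet S := measurableSet_lt measurable_snd (by fun_prop)
  have i1 : Integrable (S.indicator (fun p : ℝ × ℝ => κ p.1 p.2)) (mw.prod mv) := by
    refine hbint.mono' (hm.indicator hSm).aestronglyMeasurable ?_
    filter_upwards [hmem] with p hp
    refine (norm_indicator_le_norm_self _ _).trans (hb _ _ hp)
  have i2 : Integrable (fun p : ℝ × ℝ => κ (p.1 + p.2) p.2) (mw.prod mv) := by
    refine hbint.mono' ?_ ?_
    · have : Measurable (fun p : ℝ × ℝ => (fun p : ℝ × ℝ => κ p.1 p.2) (p.1 + p.2, p.2)) :=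
        hm.comp (by fun_prop)
      exact this.aestronglyMeasurable
    · filter_upwards [hmem] with p hp
      exact hb _ _ hp
  have e1 : ∀ w ∈ Set.Ioo t T, ∫ v in Set.Ioo 0 (w - t), κ w v
      = ∫ v, S.indicator (fun p : ℝ × ℝ => κ p.1 p.2) (w, v) ∂mv := by
    intro w hw
    have : (fun v => S.indicator (fun p : ℝ × ℝ => κ p.1 p.2) (w, v)) =
        (Set.Iio (w - t)).indicator (fun v => κ w v) := by
      ext v; simp [Set.indicator, hS]
    rw [this, hmv, setIntegral_indicator measurableSet_Iio]
    congr 2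
    ext v; simp only [Set.mem_Ioo, Set.mem_inter_iff, Set.mem_Iio]
    constructor
    · rintro ⟨h1, h2⟩; exact ⟨⟨h1, by linarith [hw.2]⟩, h2⟩
    · rintro ⟨⟨h1, _⟩, h2⟩; exact ⟨h1, h2⟩
  constructor
  · refine i1.integral_prod_left.congr ?_
    filter_upwards [ae_restrict_mem measurableSet_Ioo] with w hw
    exact (e1 w hw).symm
  · rw [setIntegral_congr_fun measurableSet_Ioo e1]
    rw [integral_integral_swap (f := fun w v => S.indicator (fun p : ℝ × ℝ => κ p.1 p.2) (w, v)) i1,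
      integral_integral_swap (f := fun w v => κ (w + v) v) i2]
    refine setIntegral_congr_fun measurableSet_Ioo fun v hv => ?_
    simp only [hmw]
    rw [← integral_indicator measurableSet_Ioo, ← integral_indicator measurableSet_Ioo,
      ← integral_add_right_eq_self (μ := (volume : Measure ℝ))
        ((Set.Ioo t T).indicator fun w => S.indicator (fun p : ℝ × ℝ => κ p.1 p.2) (w, v)) v]
    congr 1
    ext τ
    simp only [Set.indicator, hS, Set.mem_Ioo, Set.mem_ofPred_eq]
    by_cases h1 : t < τ
    · by_cases h2 : τ + v < T
      · rw [if_pos ⟨by linarith [hv.1], h2⟩, if_pos (by linarith), if_pos ⟨h1, by linarith [hv.1]⟩]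
      · rw [hz (τ + v) v (not_lt.1 h2)]; simp
    · rw [if_neg (fun h : t < τ ∧ τ < T => h1 h.1), if_neg (fun h : v < τ + v - t => h1 (by linarith))]; simp
end VR

namespace VR
open ProbabilityTheory Filter Topology Function

lemma J_dt {T m σ : ℝ} (hσ : 0 ≤ σ) {g g' : ℝ → ℝ → ℝ} (hg : GC T g) (hg' : GC T g')
    (hd : ∀ w x, HasDerivAt (g w) (g' w x) x) {a av : ℝ → ℝ → ℝ}
    (hav : ∀ y v, HasDerivAt (a y) (av y v) v)
    (hA : AC T (fun y v _ => a y v)) (hAv : AC T (fun y v _ => av y v))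
    (hAm : AC T (fun y v z => a y v * (m + σ * z / (2 * √v)))) (t x y : ℝ) (ht : t ∈ Set.Ioo 0 T) :
    HasDerivAt (fun t => J m σ T (fun y v _ => a y v) g t x y)
      (-(a y 0 * g t x + (J m σ T (fun y v _ => av y v) g t x y
        + J m σ T (fun y v z => a y v * (m + σ * z / (2 * √v))) g' t x y))) t := by
  set κ : ℝ → ℝ → ℝ := fun w v => Kin m σ (fun v _ => av y v) g x w v
    + Kin m σ (fun v z => a y v * (m + σ * z / (2 * √v))) g' x w v with hκ
  set k : ℝ → ℝ → ℝ := fun w v => Kin m σ (fun v _ => a y v) g x w v with hk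
  set Q : ℝ → ℝ := fun t => J m σ T (fun y v _ => av y v) g t x y
        + J m σ T (fun y v z => a y v * (m + σ * z / (2 * √v))) g' t x y with hQ
  have hac : Continuous (a y) := continuous_iff_continuousAt.2 fun v => (hav y v).continuousAt
  obtain ⟨B1, hB1, hb1⟩ := inner_bound (m := m) hσ hg hAv y
  obtain ⟨B2, hB2, hb2⟩ := inner_bound (m := m) hσ hg' hAm y
  have hκm : Measurable (fun p : ℝ × ℝ => κ p.1 p.2) :=
    (Kin_meas hg (hAv.meas y) x).add (Kin_meas hg' (hAm.meas y) x)
  have hκz : ∀ w v, w ∉ Set.Ioo 0 T → κ w v = 0 := by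
    intro w v hw
    simp only [hκ, Kin_zero hg x w v hw, Kin_zero hg' x w v hw, add_zero]
  have hκb : ∀ w, ∀ v ∈ Set.Ioo 0 T, |κ w v| ≤ (B1 * (1 + exp x) + B2 * (1 + exp x)) * (1 / √v) := by
    intro w v hv
    refine (abs_add_le _ _).trans ?_
    rw [add_mul]
    exact add_le_add (hb1 w x v hv) (hb2 w x v hv)
  have hQeq : ∀ τ, ∫ v in Set.Ioo 0 T, κ (τ + v) v = Q τ := by
    intro τ
    have e1 := J_eq (m := m) hσ hg hAv τ x y
    have e2 := J_eq (m := m) hσ hg' hAm τ x y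
    simp only [hQ]
    rw [e1, e2, ← integral_add]
    · rfl
    · exact (Ag_integrable hσ hg hAv τ x y).integral_prod_left
    · exact (Ag_integrable hσ hg' hAm τ x y).integral_prod_left
  have hQc : Continuous Q := by
    have c1 := (J_cont (m := m) hσ hg hAv).comp (g := fun p : ℝ × ℝ × ℝ => J m σ T (fun y v _ => av y v) g p.1 p.2.1 p.2.2)
      (f := fun t : ℝ => (t, x, y)) (by fun_prop)
    have c2 := (J_cont (m := m) hσ hg' hAm).comp (f := fun t : ℝ => (t, x, y)) (by fun_prop)
    exact c1.add c2
  have ftc : ∀ w v, 0 < v → v < T → k w v = a y 0 * g w x + ∫ v' in Set.Ioo 0 v, κ w v' := by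
    intro w v hv hvT
    have h1 := intervalIntegral.integral_eq_sub_of_hasDerivAt_of_le (f := k w) (f' := κ w) hv.le
      ((Kin_cont hσ hg hac x w).mono (Set.Icc_subset_Icc_right hvT.le))
      (fun v' hv' => Kin_deriv hσ hg hg' hd hav hA hAv hAm x y w v' ⟨hv'.1, hv'.2.trans hvT⟩) ?_
    · rw [intervalIntegral.integral_of_le hv.le, integral_Ioc_eq_integral_Ioo] at h1
      have h0 : k w 0 = a y 0 * g w x := Kin_at_zero m σ g (a y) x w
      rw [h1, h0]; ring
    · rw [intervalIntegrable_iff_integrableOn_Ioo_of_le hv.le]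
      refine IntegrableOn.mono_set (t := Set.Ioo 0 T) ?_ (Set.Ioo_subset_Ioo_right hvT.le)
      refine ((integrable_inv_sqrt T).const_mul (B1 * (1 + exp x) + B2 * (1 + exp x))).mono' ?_ ?_
      · exact (hκm.comp (measurable_prodMk_left (x := w))).aestronglyMeasurable
      · filter_upwards [ae_restrict_mem measurableSet_Ioo] with v' hv'
        exact hκb w v' hv'
  set q : ℝ → ℝ := fun w => a y 0 * g w x + Q w with hq
  obtain ⟨C, hC, hgb⟩ := hg.bound
  have hgx : Measurable (fun w => g w x) := hg.meas.comp (measurable_prodMk_right (y := x))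
  have hgint : ∀ c d : ℝ, Integrable (fun w => a y 0 * g w x) (volume.restrict (Set.Ioo c d)) := by
    intro c d
    refine Integrable.const_mul ?_ _
    refine (integrable_const (C * (1 + exp x))).mono' hgx.aestronglyMeasurable (ae_of_all _ fun w => hgb w x)
  have hQint : ∀ c d : ℝ, Integrable Q (volume.restrict (Set.Ioo c d)) := fun c d =>
    (hQc.integrableOn_Icc (a := c) (b := d)).mono_set Set.Ioo_subset_Icc_self
  have main : ∀ t ∈ Set.Ioo 0 T, J m σ T (fun y v _ => a y v) g t x y = ∫ w in t..T, q w := by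
    intro t ht
    have h1 : J m σ T (fun y v _ => a y v) g t x y = ∫ v in Set.Ioo 0 T, k (t + v) v :=
      J_eq hσ hg hA t x y
    have h2 : ∫ v in Set.Ioo 0 T, k (t + v) v = ∫ w in Set.Ioo t T, k w (w - t) := by
      rw [← integral_indicator measurableSet_Ioo, ← integral_indicator measurableSet_Ioo,
        ← integral_add_right_eq_self (μ := (volume : Measure ℝ))
          ((Set.Ioo t T).indicator fun w => k w (w - t)) t]
      congr 1; ext v
      simp only [Set.indicator, Set.mem_Ioo, add_sub_cancel_right]
      by_cases h3 : 0 < v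
      · by_cases h4 : v + t < T
        · rw [if_pos ⟨h3, by linarith [ht.1]⟩, if_pos ⟨by linarith, h4⟩, add_comm]
        · have h5 : k (t + v) v = 0 := Kin_zero hg x (t + v) v (fun h => h4 (by linarith [h.2]))
          rw [h5, if_neg (fun h : t < v + t ∧ v + t < T => h4 h.2)]; simp
      · rw [if_neg (fun h : 0 < v ∧ v < T => h3 h.1), if_neg (fun h : t < v + t ∧ v + t < T => h3 (by linarith [h.1]))]
    have h3 := tri (T := T) ht.1 κ hκm (fun w v hw => hκz w v (fun h => absurd h.2 (not_lt.2 hw))) hκb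
    rw [h1, h2, setIntegral_congr_fun measurableSet_Ioo
      (fun w hw => ftc w (w - t) (by linarith [hw.1]) (by linarith [hw.2, ht.1])),
      integral_add (hgint _ _) h3.1, h3.2]
    simp_rw [hQeq]
    rw [← integral_add (hgint _ _) (hQint _ _), intervalIntegral.integral_of_le ht.2.le,
      integral_Ioc_eq_integral_Ioo]
  have hqi : IntervalIntegrable q volume t T := by
    rw [intervalIntegrable_iff_integrableOn_Ioo_of_le ht.2.le]
    exact (hgint _ _).add (hQint _ _)
  have hqc : ContinuousAt q t := by
    have : ContinuousAt (fun w => uncurry g (w, x)) t :=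
      ContinuousAt.comp (g := uncurry g) (f := fun w : ℝ => (w, x)) (hg.contAt t x ht.1.ne' ht.2.ne) (by fun_prop)
    exact (continuousAt_const.mul this).add hQc.continuousAt
  have hqm : Measurable q := (hgx.const_mul _).add hQc.measurable
  have hder := intervalIntegral.integral_hasDerivAt_left hqi
    hqm.stronglyMeasurable.stronglyMeasurableAtFilter hqc
  refine hder.congr_of_eventuallyEq ?_
  filter_upwards [Ioo_mem_nhds ht.1 ht.2] with t' ht'
  exact main t' ht'
end VR

namespace VR
open ProbabilityTheory Filter Topology Function

lemma AC_of {T : ℝ} {b : ℝ → ℝ → ℝ} (hb : Continuous (uncurry b)) {c : ℝ → ℝ → ℝ}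
    (hc : Measurable (uncurry c)) {N : ℝ} (hN : 0 ≤ N)
    (hcb : ∀ v ∈ Set.Ioo 0 T, ∀ z, |c v z| ≤ N * (1 / √v * exp |z|)) :
    AC T (fun y v z => b y v * c v z) where
  meas y := by
    have h1 : Measurable (fun q : ℝ × ℝ => uncurry b (y, q.1)) := hb.measurable.comp (by fun_prop)
    exact h1.mul hc
  cont v _ z := by
    have h1 : Continuous (fun y : ℝ => uncurry b (y, v)) := hb.comp (by fun_prop)
    exact h1.mul continuous_const
  bound y0 := by
    obtain ⟨M, hM⟩ := ((isCompact_closedBall y0 1).prod (isCompact_Icc (a := (0:ℝ)) (b := T))).exists_bound_of_continuousOn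
      hb.continuousOn
    refine ⟨max M 0 * N, by positivity, fun y hy v hv z => ?_⟩
    have h1 : |b y v| ≤ max M 0 :=
      (hM (y, v) ⟨Metric.ball_subset_closedBall hy, hv.1.le, hv.2.le⟩).trans (le_max_left _ _)
    rw [abs_mul, mul_assoc]
    exact mul_le_mul h1 (hcb v hv z) (abs_nonneg _) (le_max_right _ _)

lemma one_bd {T v z : ℝ} (hv : v ∈ Set.Ioo 0 T) : 1 ≤ √T * (1 / √v * exp |z|) := by
  have h1 : 0 < √v := Real.sqrt_pos.2 hv.1
  have h2 : √v ≤ √T := Real.sqrt_le_sqrt hv.2.le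
  have h3 : 1 ≤ exp |z| := one_le_exp (abs_nonneg z)
  have h4 : 1 ≤ √T * (1 / √v) := by rw [mul_one_div, one_le_div h1]; exact h2
  nlinarith

lemma AC_one {T : ℝ} {b : ℝ → ℝ → ℝ} (hb : Continuous (uncurry b)) : AC T (fun y v _ => b y v) := by
  have := AC_of (T := T) hb (c := fun _ _ => 1) measurable_const (N := √T) (Real.sqrt_nonneg _)
    (fun v hv z => by simpa using one_bd hv)
  simpa using this

lemma z_bd {v z : ℝ} : |z| * (1 / √v) ≤ 1 / √v * exp |z| := by
  have := add_one_le_exp |z|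
  have h2 : 0 ≤ 1 / √v := by positivity
  nlinarith

lemma AC_ker {T σ : ℝ} (hσ : 0 < σ) {b : ℝ → ℝ → ℝ} (hb : Continuous (uncurry b)) :
    AC T (fun y v z => b y v * (z / (σ * √v))) := by
  refine AC_of hb (c := fun v z => z / (σ * √v)) (by unfold uncurry; fun_prop) (N := 1 / σ) (by positivity) (fun v hv z => ?_)
  have h1 : |z / (σ * √v)| = 1 / σ * (|z| * (1 / √v)) := by
    rw [abs_div, abs_of_nonneg (by positivity : 0 ≤ σ * √v)]; field_simp
  rw [h1]
  exact mul_le_mul_of_nonneg_left z_bd (by positivity)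

lemma AC_m {T σ m : ℝ} (hσ : 0 < σ) {b : ℝ → ℝ → ℝ} (hb : Continuous (uncurry b)) :
    AC T (fun y v z => b y v * (m + σ * z / (2 * √v))) := by
  refine AC_of hb (c := fun v z => m + σ * z / (2 * √v)) (by unfold uncurry; fun_prop) (N := |m| * √T + σ / 2) (by positivity) (fun v hv z => ?_)
  have h1 : |σ * z / (2 * √v)| = σ / 2 * (|z| * (1 / √v)) := by
    rw [abs_div, abs_mul, abs_of_pos hσ, abs_of_nonneg (by positivity : 0 ≤ 2 * √v)]; field_simp
  refine (abs_add_le _ _).trans ?_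
  rw [h1, add_mul, mul_assoc]
  have h2 := one_bd (z := z) hv
  have h3 := z_bd (v := v) (z := z)
  have h4 : |m| * 1 ≤ |m| * (√T * (1 / √v * exp |z|)) := by gcongr
  have h5 : σ / 2 * (|z| * (1 / √v)) ≤ σ / 2 * (1 / √v * exp |z|) := by gcongr
  linarith

lemma ext_C1 {f : ℝ → ℝ} (hf : ContDiffOn ℝ 1 f (Set.Ici 0)) :
    ∃ fe fe' : ℝ → ℝ, Continuous fe' ∧ (∀ y, HasDerivAt fe (fe' y) y) ∧ ∀ y, 0 ≤ y → fe y = f y := by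
  have hc : ContinuousOn (derivWithin f (Set.Ici 0)) (Set.Ici 0) :=
    hf.continuousOn_derivWithin (uniqueDiffOn_Ici 0) le_rfl
  set fe' : ℝ → ℝ := fun y => derivWithin f (Set.Ici 0) (max y 0) with hfe'
  have hfc : Continuous fe' :=
    hc.comp_continuous (by fun_prop) (fun y => le_max_right y 0)
  refine ⟨fun y => f 0 + ∫ u in (0:ℝ)..y, fe' u, fe', hfc, fun y => ?_, fun y hy => ?_⟩
  · exact (intervalIntegral.integral_hasDerivAt_right (hfc.intervalIntegrable _ _)
      hfc.stronglyMeasurable.stronglyMeasurableAtFilter hfc.continuousAt).const_add _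
  · have := intervalIntegral.integral_eq_sub_of_hasDerivAt_of_le (f := f) (f' := fe') hy
      (hf.continuousOn.mono Set.Icc_subset_Ici_self) (fun u hu => ?_) (hfc.intervalIntegrable _ _)
    · simp only; rw [this]; ring
    · have hd := (hf.differentiableOn one_ne_zero u hu.1.le).hasDerivWithinAt
      have := hd.hasDerivAt (Ici_mem_nhds hu.1)
      simpa [hfe', max_eq_left hu.1.le] using this

/-- `C^{1,2,1}` on `U` -/
def C121 (U : Set (ℝ × ℝ × ℝ)) (φ : ℝ → ℝ → ℝ → ℝ) : Prop :=
  ContinuousOn (fun q : ℝ × ℝ × ℝ => φ q.1 q.2.1 q.2.2) U ∧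
  ∃ Dt Ds Dss Dy : ℝ → ℝ → ℝ → ℝ,
    (∀ t s y : ℝ, (t, s, y) ∈ U →
        HasDerivAt (fun τ => φ τ s y) (Dt t s y) t ∧
        HasDerivAt (fun w => φ t w y) (Ds t s y) s ∧
        HasDerivAt (fun w => Ds t w y) (Dss t s y) s ∧
        HasDerivAt (fun u => φ t s u) (Dy t s y) y) ∧
      (ContinuousOn (fun q : ℝ × ℝ × ℝ => Dt q.1 q.2.1 q.2.2) U ∧
            ContinuousOn (fun q : ℝ × ℝ × ℝ => Ds q.1 q.2.1 q.2.2) U ∧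
            ContinuousOn (fun q : ℝ × ℝ × ℝ => Dss q.1 q.2.1 q.2.2) U ∧
            ContinuousOn (fun q : ℝ × ℝ × ℝ => Dy q.1 q.2.1 q.2.2) U)

lemma C121.congr {U : Set (ℝ × ℝ × ℝ)} (hU : IsOpen U) {φ ψ : ℝ → ℝ → ℝ → ℝ} (h : C121 U ψ)
    (he : ∀ t s y, (t, s, y) ∈ U → φ t s y = ψ t s y) : C121 U φ := by
  obtain ⟨hc, Dt, Ds, Dss, Dy, h1, h2⟩ := h
  refine ⟨hc.congr fun q hq => he _ _ _ hq, Dt, Ds, Dss, Dy, fun t s y hq => ?_, h2⟩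
  obtain ⟨a1, a2, a3, a4⟩ := h1 t s y hq
  have e1 : ∀ᶠ τ in 𝓝 t, (τ, s, y) ∈ U :=
    (Continuous.tendsto (f := fun τ : ℝ => (τ, s, y)) (by fun_prop) t).eventually (hU.mem_nhds hq)
  have e2 : ∀ᶠ τ in 𝓝 s, (t, τ, y) ∈ U :=
    (Continuous.tendsto (f := fun τ : ℝ => (t, τ, y)) (by fun_prop) s).eventually (hU.mem_nhds hq)
  have e3 : ∀ᶠ τ in 𝓝 y, (t, s, τ) ∈ U :=
    (Continuous.tendsto (f := fun τ : ℝ => (t, s, τ)) (by fun_prop) y).eventually (hU.mem_nhds hq)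
  exact ⟨a1.congr_of_eventuallyEq (e1.mono fun _ h => he _ _ _ h),
    a2.congr_of_eventuallyEq (e2.mono fun _ h => he _ _ _ h), a3,
    a4.congr_of_eventuallyEq (e3.mono fun _ h => he _ _ _ h)⟩

lemma C121.add {U : Set (ℝ × ℝ × ℝ)} {φ ψ : ℝ → ℝ → ℝ → ℝ} (h : C121 U φ) (h' : C121 U ψ) :
    C121 U (fun t s y => φ t s y + ψ t s y) := by
  obtain ⟨hc, Dt, Ds, Dss, Dy, h1, c1, c2, c3, c4⟩ := h
  obtain ⟨hc', Dt', Ds', Dss', Dy', h1', c1', c2', c3', c4'⟩ := h'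
  refine ⟨hc.add hc', fun t s y => Dt t s y + Dt' t s y, fun t s y => Ds t s y + Ds' t s y,
    fun t s y => Dss t s y + Dss' t s y, fun t s y => Dy t s y + Dy' t s y, fun t s y hq => ?_,
    c1.add c1', c2.add c2', c3.add c3', c4.add c4'⟩
  obtain ⟨a1, a2, a3, a4⟩ := h1 t s y hq
  obtain ⟨b1, b2, b3, b4⟩ := h1' t s y hq
  exact ⟨a1.add b1, a2.add b2, a3.add b3, a4.add b4⟩

lemma C121.mul {U : Set (ℝ × ℝ × ℝ)} {φ ψ : ℝ → ℝ → ℝ → ℝ} (h : C121 U φ) (h' : C121 U ψ) :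
    C121 U (fun t s y => φ t s y * ψ t s y) := by
  obtain ⟨hc, Dt, Ds, Dss, Dy, h1, c1, c2, c3, c4⟩ := h
  obtain ⟨hc', Dt', Ds', Dss', Dy', h1', c1', c2', c3', c4'⟩ := h'
  refine ⟨hc.mul hc', fun t s y => Dt t s y * ψ t s y + φ t s y * Dt' t s y,
    fun t s y => Ds t s y * ψ t s y + φ t s y * Ds' t s y,
    fun t s y => (Dss t s y * ψ t s y + Ds t s y * Ds' t s y) + (Ds t s y * Ds' t s y + φ t s y * Dss' t s y),
    fun t s y => Dy t s y * ψ t s y + φ t s y * Dy' t s y, fun t s y hq => ?_,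
    (c1.mul hc').add (hc.mul c1'), (c2.mul hc').add (hc.mul c2'),
    ((c3.mul hc').add (c2.mul c2')).add ((c2.mul c2').add (hc.mul c3')), (c4.mul hc').add (hc.mul c4')⟩
  obtain ⟨a1, a2, a3, a4⟩ := h1 t s y hq
  obtain ⟨b1, b2, b3, b4⟩ := h1' t s y hq
  exact ⟨a1.mul b1, a2.mul b2, (a3.mul b2).add (a2.mul b3), a4.mul b4⟩

lemma C121_of_contDiffOn {U : Set (ℝ × ℝ × ℝ)} (hU : IsOpen U) {φ : ℝ → ℝ → ℝ → ℝ}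
    (h : ContDiffOn ℝ 2 (fun q : ℝ × ℝ × ℝ => φ q.1 q.2.1 q.2.2) U) : C121 U φ := by
  set Φ : ℝ × ℝ × ℝ → ℝ := fun q => φ q.1 q.2.1 q.2.2 with hΦ
  have hf1 : ContDiffOn ℝ 1 (fderiv ℝ Φ) U := h.fderiv_of_isOpen hU (by norm_num)
  have hev : ∀ e : ℝ × ℝ × ℝ, ContDiffOn ℝ 1 (fun q => fderiv ℝ Φ q e) U := fun e =>
    hf1.clm_apply contDiffOn_const
  have hf2 : ContinuousOn (fderiv ℝ (fun q => fderiv ℝ Φ q (0, 1, 0))) U :=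
    (hev (0, 1, 0)).continuousOn_fderiv_of_isOpen hU le_rfl
  refine ⟨h.continuousOn, fun t s y => fderiv ℝ Φ (t, s, y) (1, 0, 0),
    fun t s y => fderiv ℝ Φ (t, s, y) (0, 1, 0),
    fun t s y => fderiv ℝ (fun q => fderiv ℝ Φ q (0, 1, 0)) (t, s, y) (0, 1, 0),
    fun t s y => fderiv ℝ Φ (t, s, y) (0, 0, 1), fun t s y hq => ?_,
    (hev _).continuousOn, (hev _).continuousOn, hf2.clm_apply continuousOn_const, (hev _).continuousOn⟩
  have hd : HasFDerivAt Φ (fderiv ℝ Φ (t, s, y)) (t, s, y) :=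
    ((h.differentiableOn two_ne_zero).differentiableAt (hU.mem_nhds hq)).hasFDerivAt
  have hd2 : HasFDerivAt (fun q => fderiv ℝ Φ q (0, 1, 0)) (fderiv ℝ (fun q => fderiv ℝ Φ q (0, 1, 0)) (t, s, y)) (t, s, y) :=
    (((hev (0, 1, 0)).differentiableOn one_ne_zero).differentiableAt (hU.mem_nhds hq)).hasFDerivAt
  have l1 : HasDerivAt (fun τ : ℝ => (τ, s, y)) (1, 0, 0) t :=
    (hasDerivAt_id t).prodMk ((hasDerivAt_const t s).prodMk (hasDerivAt_const t y))
  have l2 : HasDerivAt (fun τ : ℝ => (t, τ, y)) (0, 1, 0) s :=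
    (hasDerivAt_const s t).prodMk ((hasDerivAt_id s).prodMk (hasDerivAt_const s y))
  have l3 : HasDerivAt (fun τ : ℝ => (t, s, τ)) (0, 0, 1) y :=
    (hasDerivAt_const y t).prodMk ((hasDerivAt_const y s).prodMk (hasDerivAt_id y))
  have k1 := HasFDerivAt.comp_hasDerivAt (f := fun τ : ℝ => (τ, s, y)) t hd l1
  have k2 := HasFDerivAt.comp_hasDerivAt (f := fun τ : ℝ => (t, τ, y)) s hd l2
  have k3 := HasFDerivAt.comp_hasDerivAt (f := fun τ : ℝ => (t, τ, y)) s hd2 l2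
  have k4 := HasFDerivAt.comp_hasDerivAt (f := fun τ : ℝ => (t, s, τ)) y hd l3
  exact ⟨k1, k2, k3, k4⟩

lemma isOpen_domD (T : ℝ) : IsOpen (domD T) := by
  unfold domD
  refine (isOpen_lt continuous_const continuous_fst).inter
    ((isOpen_lt continuous_fst continuous_const).inter
    ((isOpen_lt continuous_const continuous_snd.fst).inter
    ((isOpen_lt continuous_const continuous_snd.snd).inter
    (isOpen_lt continuous_snd.snd continuous_fst))))

/-- the Volterra part is `C^{1,2,1}` -/
lemma C121_W {T r σ m : ℝ} (hσ : 0 < σ) {fe fe' : ℝ → ℝ} (hfe' : Continuous fe')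
    (hfe : ∀ y, HasDerivAt fe (fe' y) y) {g g' : ℝ → ℝ → ℝ} (hg : GC T g) (hg' : GC T g')
    (hd : ∀ w x, HasDerivAt (g w) (g' w x) x) :
    C121 (domD T) (fun t s y => J m σ T (fun y v _ => exp (-r * v) * fe (y + v)) g t (log s) y) := by
  have hfc : Continuous fe := continuous_iff_continuousAt.2 fun v => (hfe v).continuousAt
  set a : ℝ → ℝ → ℝ := fun y v => exp (-r * v) * fe (y + v) with ha
  set ay : ℝ → ℝ → ℝ := fun y v => exp (-r * v) * fe' (y + v) with hay
  set av : ℝ → ℝ → ℝ := fun y v => exp (-r * v) * (-r) * fe (y + v) + exp (-r * v) * fe' (y + v) with hav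
  have ca : Continuous (uncurry a) := by simp only [ha, uncurry]; fun_prop
  have cay : Continuous (uncurry ay) := by simp only [hay, uncurry]; fun_prop
  have cav : Continuous (uncurry av) := by simp only [hav, uncurry]; fun_prop
  have da : ∀ y v, HasDerivAt (a y) (av y v) v := by
    intro y v
    have h1 : HasDerivAt (fun v : ℝ => exp (-r * v)) (exp (-r * v) * (-r)) v := by
      simpa using ((hasDerivAt_id v).const_mul (-r)).exp
    exact h1.mul ((hfe (y + v)).comp_const_add y v)
  have day : ∀ y, ∀ v ∈ Set.Ioo 0 T, ∀ _z : ℝ, HasDerivAt (fun y => a y v) (ay y v) y := by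
    intro y v _ _
    exact ((hfe (y + v)).comp_add_const y v).const_mul _
  have A1 : AC T (fun y v _ => a y v) := AC_one ca
  have A2 : AC T (fun y v _ => ay y v) := AC_one cay
  have A3 : AC T (fun y v _ => av y v) := AC_one cav
  have A4 := AC_ker (T := T) hσ ca
  have A5 := AC_m (T := T) (m := m) hσ ca
  have clog : ContinuousOn (fun q : ℝ × ℝ × ℝ => (q.1, log q.2.1, q.2.2)) (domD T) := by
    refine continuousOn_fst.prodMk (ContinuousOn.prodMk ?_ continuousOn_snd.snd)
    exact ContinuousOn.log continuousOn_snd.fst (fun q hq => hq.2.2.1.ne')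
  have cJ : ∀ {A : ℝ → ℝ → ℝ → ℝ} {G : ℝ → ℝ → ℝ}, AC T A → GC T G →
      ContinuousOn (fun q : ℝ × ℝ × ℝ => J m σ T A G q.1 (log q.2.1) q.2.2) (domD T) := by
    intro A G hA hG
    exact (J_cont hσ.le hG hA).comp_continuousOn clog
  have cinv : ContinuousOn (fun q : ℝ × ℝ × ℝ => q.2.1⁻¹) (domD T) :=
    ContinuousOn.inv₀ continuousOn_snd.fst (fun q hq => hq.2.2.1.ne')
  have cg : ContinuousOn (fun q : ℝ × ℝ × ℝ => g q.1 (log q.2.1)) (domD T) := by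
    have : ContinuousOn (fun q : ℝ × ℝ × ℝ => (q.1, log q.2.1)) (domD T) :=
      continuousOn_fst.prodMk (ContinuousOn.log continuousOn_snd.fst (fun q hq => hq.2.2.1.ne'))
    exact hg.cont.comp this (fun q hq => ⟨⟨hq.1, hq.2.1⟩, trivial⟩)
  have ca0 : ContinuousOn (fun q : ℝ × ℝ × ℝ => a q.2.2 0) (domD T) := by
    have : Continuous (fun q : ℝ × ℝ × ℝ => uncurry a (q.2.2, 0)) := ca.comp (by fun_prop)
    exact this.continuousOn
  refine ⟨cJ A1 hg,
    fun t s y => -(a y 0 * g t (log s) + (J m σ T (fun y v _ => av y v) g t (log s) y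
        + J m σ T (fun y v z => a y v * (m + σ * z / (2 * √v))) g' t (log s) y)),
    fun t s y => J m σ T (fun y v _ => a y v) g' t (log s) y * s⁻¹,
    fun t s y => (J m σ T (fun y v z => a y v * (z / (σ * √v))) g' t (log s) y * s⁻¹) * s⁻¹
      + J m σ T (fun y v _ => a y v) g' t (log s) y * (-(s ^ 2)⁻¹),
    fun t s y => J m σ T (fun y v _ => ay y v) g t (log s) y, fun t s y hq => ⟨?_, ?_, ?_, ?_⟩,
    ((ca0.mul cg).add ((cJ A3 hg).add (cJ A5 hg'))).neg, (cJ A1 hg').mul cinv, ?_, cJ A2 hg⟩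
  · exact J_dt hσ.le hg hg' hd da A1 A3 A5 t (log s) y ⟨hq.1, hq.2.1⟩
  · exact (J_dx_easy hσ.le hg hg' hd A1 t (log s) y).comp s (Real.hasDerivAt_log hq.2.2.1.ne')
  · exact ((J_dx_kernel hσ hg' A1 A4 t (log s) y).comp s (Real.hasDerivAt_log hq.2.2.1.ne')).mul
      (hasDerivAt_inv hq.2.2.1.ne')
  · exact J_dy hσ.le hg A1 A2 day t (log s) y
  · refine (((cJ A4 hg').mul cinv).mul cinv).add ((cJ A1 hg').mul (ContinuousOn.neg ?_))
    exact ContinuousOn.inv₀ (continuousOn_snd.fst.pow 2) (fun q hq => pow_ne_zero 2 hq.2.2.1.ne')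
end VR

namespace VR
open ProbabilityTheory Filter Topology Function

/-- standard normal density -/
noncomputable def pdf (u : ℝ) : ℝ := Real.exp (-u ^ 2 / 2) / Real.sqrt (2 * Real.pi)

lemma pdf_contDiff : ContDiff ℝ 1 pdf := by
  unfold pdf; fun_prop

lemma pdf_cont : Continuous pdf := pdf_contDiff.continuous

lemma pdf_nonneg (u : ℝ) : 0 ≤ pdf u := by unfold pdf; positivity

lemma pdf_int : Integrable pdf := by
  have h := (integrable_exp_neg_mul_sq (b := 1 / 2) (by norm_num)).div_const (√(2 * π))
  refine h.congr (ae_of_all _ fun u => ?_)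
  simp only [pdf]; congr 2; ring

lemma cdf_eq (x : ℝ) : stdNormalCDF x = stdNormalCDF 0 + ∫ u in (0:ℝ)..x, pdf u := by
  have := intervalIntegral.integral_Iic_sub_Iic (a := 0) (b := x) (f := pdf) (μ := volume)
    pdf_int.integrableOn pdf_int.integrableOn
  rw [← this]
  simp only [stdNormalCDF, pdf]; ring

lemma cdf_deriv (x : ℝ) : HasDerivAt stdNormalCDF (pdf x) x := by
  have h : stdNormalCDF = fun x => stdNormalCDF 0 + ∫ u in (0:ℝ)..x, pdf u := funext cdf_eq
  rw [h]
  exact (pdf_cont.integral_hasStrictDerivAt 0 x).hasDerivAt.const_add _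

lemma cdf_contDiff : ContDiff ℝ 2 stdNormalCDF := by
  have : (2 : WithTop ℕ∞) = 1 + 1 := by norm_num
  rw [this, contDiff_succ_iff_deriv]
  refine ⟨fun x => (cdf_deriv x).differentiableAt, by simp, ?_⟩
  have : deriv stdNormalCDF = pdf := funext fun x => (cdf_deriv x).deriv
  rw [this]; exact pdf_contDiff

lemma cdf_bdd : ∃ N, 0 ≤ N ∧ ∀ x, |stdNormalCDF x| ≤ N := by
  refine ⟨∫ u, pdf u, integral_nonneg pdf_nonneg, fun x => ?_⟩
  have h0 : stdNormalCDF x = ∫ u in Set.Iic x, pdf u := rfl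
  rw [h0, abs_of_nonneg (integral_nonneg pdf_nonneg)]
  exact setIntegral_le_integral pdf_int (ae_of_all _ pdf_nonneg)

lemma bs_contDiffOn {r σ K T : ℝ} (hσ : 0 < σ) (hK : 0 < K) :
    ContDiffOn ℝ 2 (fun q : ℝ × ℝ × ℝ => bsPrice r σ K T q.1 q.2.1) (domD T) := by
  have e : ∀ q ∈ domD T, bsPrice r σ K T q.1 q.2.1 =
      q.2.1 * stdNormalCDF ((Real.log (q.2.1 / K) + (r + σ ^ 2 / 2) * (T - q.1)) / (σ * Real.sqrt (T - q.1)))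
      - K * Real.exp (-r * (T - q.1)) *
        stdNormalCDF ((Real.log (q.2.1 / K) + (r + σ ^ 2 / 2) * (T - q.1)) / (σ * Real.sqrt (T - q.1))
          - σ * Real.sqrt (T - q.1)) := by
    intro q hq
    rw [bsPrice, if_neg (not_le.2 hq.2.2.1), if_pos hq.2.1]
  refine ContDiffOn.congr ?_ e
  have c1 : ContDiffOn ℝ 2 (fun q : ℝ × ℝ × ℝ => T - q.1) (domD T) := by fun_prop
  have cs : ContDiffOn ℝ 2 (fun q : ℝ × ℝ × ℝ => q.2.1) (domD T) := by fun_prop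
  have c2 : ContDiffOn ℝ 2 (fun q : ℝ × ℝ × ℝ => σ * √(T - q.1)) (domD T) :=
    contDiffOn_const.mul (c1.sqrt fun q hq => (sub_pos.2 hq.2.1).ne')
  have c3 : ContDiffOn ℝ 2 (fun q : ℝ × ℝ × ℝ => Real.log (q.2.1 / K)) (domD T) :=
    ContDiffOn.log (cs.div_const K) (fun q hq => (div_pos hq.2.2.1 hK).ne')
  have c4 : ContDiffOn ℝ 2 (fun q : ℝ × ℝ × ℝ => (Real.log (q.2.1 / K) + (r + σ ^ 2 / 2) * (T - q.1)) / (σ * Real.sqrt (T - q.1))) (domD T) :=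
    (c3.add (contDiffOn_const.mul c1)).div c2
      (fun q hq => (mul_pos hσ (Real.sqrt_pos.2 (sub_pos.2 hq.2.1))).ne')
  exact (cs.mul (cdf_contDiff.comp_contDiffOn c4)).sub
    ((contDiffOn_const.mul (contDiffOn_const.mul c1).exp).mul (cdf_contDiff.comp_contDiffOn (c4.sub c2)))

/-- the log-derivative of the Black-Scholes price -/
noncomputable def bsD (r σ K T t ξ : ℝ) : ℝ :=
  exp ξ * stdNormalCDF ((ξ - log K + (r + σ ^ 2 / 2) * (T - t)) / (σ * √(T - t)))

lemma bs_deriv {r σ K T t : ℝ} (hσ : 0 < σ) (hK : 0 < K) (ht : t < T) (ξ : ℝ) :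
    HasDerivAt (fun ξ => bsPrice r σ K T t (exp ξ)) (bsD r σ K T t ξ) ξ := by
  have hτ : 0 < T - t := sub_pos.2 ht
  set a := σ * √(T - t) with ha
  have ha0 : 0 < a := mul_pos hσ (Real.sqrt_pos.2 hτ)
  have ha2 : a ^ 2 = σ ^ 2 * (T - t) := by rw [ha, mul_pow, Real.sq_sqrt hτ.le]
  have e : (fun ξ => bsPrice r σ K T t (exp ξ)) = fun ξ =>
      exp ξ * stdNormalCDF ((ξ - log K + (r + σ ^ 2 / 2) * (T - t)) / a)
      - K * exp (-r * (T - t)) * stdNormalCDF ((ξ - log K + (r + σ ^ 2 / 2) * (T - t)) / a - a) := by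
    funext ξ
    rw [bsPrice, if_neg (not_le.2 (exp_pos ξ)), if_pos ht, Real.log_div (exp_pos ξ).ne' hK.ne', log_exp]
  rw [e]
  set d : ℝ → ℝ := fun ξ => (ξ - log K + (r + σ ^ 2 / 2) * (T - t)) / a with hd
  have hd1 : HasDerivAt d (1 / a) ξ := (((hasDerivAt_id ξ).sub_const _).add_const _).div_const a
  have hd2 : HasDerivAt (fun ξ => d ξ - a) (1 / a) ξ := hd1.sub_const a
  have h := ((Real.hasDerivAt_exp ξ).mul ((cdf_deriv (d ξ)).comp ξ hd1)).sub
    (((cdf_deriv (d ξ - a)).comp ξ hd2).const_mul (K * exp (-r * (T - t))))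
  have key : exp ξ * pdf (d ξ) = K * exp (-r * (T - t)) * pdf (d ξ - a) := by
    have : K = exp (log K) := (exp_log hK).symm
    rw [this]
    simp only [pdf, ← mul_div_assoc, ← exp_add]
    congr 2
    have hda : d ξ * a = ξ - log K + (r + σ ^ 2 / 2) * (T - t) := by
      simp only [hd]; field_simp
    nlinarith
  refine h.congr_deriv ?_
  have : bsD r σ K T t ξ = exp ξ * stdNormalCDF (d ξ) := rfl
  rw [this]
  simp only [comp]
  linear_combination (1 / a) * key

lemma bsD_cont {r σ K T : ℝ} (hσ : 0 < σ) :
    ContinuousOn (fun q : ℝ × ℝ => bsD r σ K T q.1 q.2) (Set.Ioo 0 T ×ˢ Set.univ) := by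
  unfold bsD
  refine ContinuousOn.mul (by fun_prop) (cdf_contDiff.continuous.comp_continuousOn ?_)
  refine ContinuousOn.div (by fun_prop) (by fun_prop) ?_
  rintro q ⟨hq, -⟩
  exact (mul_pos hσ (Real.sqrt_pos.2 (sub_pos.2 hq.2))).ne'

lemma bsD_bound : ∃ N, 0 ≤ N ∧ ∀ r σ K T t ξ, |bsD r σ K T t ξ| ≤ N * (1 + exp ξ) := by
  obtain ⟨N, hN, h⟩ := cdf_bdd
  refine ⟨N, hN, fun r σ K T t ξ => ?_⟩
  rw [bsD, abs_mul, abs_of_pos (exp_pos _)]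
  have := mul_le_mul_of_nonneg_left (h ((ξ - log K + (r + σ ^ 2 / 2) * (T - t)) / (σ * √(T - t)))) (exp_pos ξ).le
  nlinarith

/-- change of variables in the log-normal integral -/
lemma chvar {r σ s v : ℝ} (hσ : 0 < σ) (hs : 0 < s) (hv : 0 < v) (H : ℝ → ℝ) :
    ∫ x in Set.Ioi (0:ℝ), H x * lnKernel r σ x s v =
      ∫ z, H (exp (log s + (r - σ ^ 2 / 2) * v + σ * √v * z)) ∂gam := by
  have hv' : 0 < √v := Real.sqrt_pos.2 hv
  have ha : 0 < σ * √v := mul_pos hσ hv'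
  set e : ℝ → ℝ := fun z => exp (log s + (r - σ ^ 2 / 2) * v + σ * √v * z) with he
  have hder : ∀ z ∈ (Set.univ : Set ℝ), HasDerivWithinAt e (e z * (σ * √v)) Set.univ z := by
    intro z _
    have : HasDerivAt (fun z => log s + (r - σ ^ 2 / 2) * v + σ * √v * z) (σ * √v) z := by
      simpa using ((hasDerivAt_id z).const_mul (σ * √v)).const_add (log s + (r - σ ^ 2 / 2) * v)
    exact this.exp.hasDerivWithinAt
  have hinj : Set.InjOn e Set.univ := by
    intro z _ z' _ h
    have := exp_injective h
    have h2 : σ * √v * z = σ * √v * z' := by linarith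
    exact mul_left_cancel₀ ha.ne' h2
  have him : e '' Set.univ = Set.Ioi 0 := by
    ext x
    simp only [Set.image_univ, Set.mem_range, Set.mem_Ioi]
    constructor
    · rintro ⟨z, rfl⟩; exact exp_pos _
    · intro hx
      refine ⟨(log x - (log s + (r - σ ^ 2 / 2) * v)) / (σ * √v), ?_⟩
      simp only [he]
      rw [mul_div_cancel₀ _ ha.ne', add_sub_cancel, exp_log hx]
  rw [← him, integral_image_eq_integral_abs_deriv_smul MeasurableSet.univ hder hinj,
    integral_gaussianReal_eq_integral_smul one_ne_zero, setIntegral_univ]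
  refine integral_congr_ae (ae_of_all _ fun z => ?_)
  have hez : 0 < e z := exp_pos _
  have hL : lnL r σ (e z) s v = z := by
    rw [lnL, Real.log_div hez.ne' hs.ne']
    simp only [he, log_exp]
    field_simp
    ring
  simp only [smul_eq_mul]
  rw [lnKernel, hL, abs_of_pos (mul_pos hez ha), gaussianPDFReal]
  simp only [NNReal.coe_one, mul_one, sub_zero]
  change _ = _ * H (e z)
  generalize e z = E at *
  field_simp

lemma GC.sum {ι : Type*} [Fintype ι] {T : ℝ} {h : ι → ℝ → ℝ → ℝ} (hh : ∀ j, GC T (h j)) (p : ι → ℝ) :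
    GC T (fun w x => ∑ j, p j * h j w x) := by
  refine ⟨?_, ?_, ?_⟩
  · have : ∀ j, ContinuousOn (fun q : ℝ × ℝ => p j * h j q.1 q.2) (Set.Ioo 0 T ×ˢ Set.univ) :=
      fun j => continuousOn_const.mul (hh j).cont
    exact continuousOn_finsetSum _ fun j _ => this j
  · intro w hw x
    exact Finset.sum_eq_zero fun j _ => by rw [(hh j).zero w hw x, mul_zero]
  · choose C hC hb using fun j => (hh j).bound
    refine ⟨∑ j, |p j| * C j, Finset.sum_nonneg fun j _ => mul_nonneg (abs_nonneg _) (hC j), fun w x => ?_⟩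
    refine (Finset.abs_sum_le_sum_abs _ _).trans ?_
    rw [Finset.sum_mul]
    refine Finset.sum_le_sum fun j _ => ?_
    rw [abs_mul, mul_assoc]
    exact mul_le_mul_of_nonneg_left (hb j w x) (abs_nonneg _)
end VR

namespace VR
open ProbabilityTheory Filter Topology Function

/-- the trace of the solution at age zero, in logarithmic price -/
noncomputable def hfun {k : ℕ} (T : ℝ) (φ : ℝ → ℝ → Fin k → ℝ → ℝ) (j : Fin k) (w ξ : ℝ) : ℝ :=
  open Classical in if w ∈ Set.Ioo 0 T then φ w (exp ξ) j 0 else 0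

lemma hfun_pos {k : ℕ} {T : ℝ} {φ : ℝ → ℝ → Fin k → ℝ → ℝ} {j : Fin k} {w : ℝ} (hw : w ∈ Set.Ioo 0 T)
    (ξ : ℝ) : hfun T φ j w ξ = φ w (exp ξ) j 0 := by
  rw [hfun, if_pos hw]

lemma tend0 {k : ℕ} {T : ℝ} {φ : ℝ → ℝ → Fin k → ℝ → ℝ} (hφc : ContOnClosure T φ) (j : Fin k)
    {w s : ℝ} (hw : w ∈ Set.Ioo 0 T) (hs : 0 < s) :
    Tendsto (fun y => φ w s j y) (𝓝[>] 0) (𝓝 (φ w s j 0)) := by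
  have h := hφc j (w, s, 0) ⟨hw.1.le, hw.2.le, hs.le, le_rfl, hw.1.le⟩
  have h2 : Tendsto (fun y : ℝ => (w, s, y)) (𝓝[>] 0) (𝓝[domDbar T] (w, s, 0)) := by
    refine tendsto_nhdsWithin_iff.2 ⟨?_, ?_⟩
    · exact (Continuous.tendsto (f := fun y : ℝ => (w, s, y)) (by fun_prop) 0).mono_left nhdsWithin_le_nhds
    · filter_upwards [Ioo_mem_nhdsGT hw.1] with y hy
      exact ⟨hw.1.le, hw.2.le, hs.le, hy.1.le, hy.2.le⟩
  have h3 : Tendsto (fun q : ℝ × ℝ × ℝ => φ q.1 q.2.1 j q.2.2) (𝓝[domDbar T] (w, s, 0)) (𝓝 (φ w s j 0)) := h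
  exact h3.comp h2

lemma hfun_GC {k : ℕ} {T : ℝ} {φ : ℝ → ℝ → Fin k → ℝ → ℝ} (hφc : ContOnClosure T φ)
    (hφg : LinGrowth T φ) (j : Fin k) : GC T (hfun T φ j) := by
  refine ⟨?_, fun w hw x => by rw [hfun, if_neg hw], ?_⟩
  · have h1 : ContinuousOn (fun q : ℝ × ℝ => φ q.1 (exp q.2) j 0) (Set.Ioo 0 T ×ˢ Set.univ) := by
      refine (hφc j).comp (f := fun q : ℝ × ℝ => (q.1, exp q.2, (0:ℝ))) (by fun_prop) ?_
      rintro q ⟨hq, -⟩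
      exact ⟨hq.1.le, hq.2.le, (exp_pos _).le, le_rfl, hq.1.le⟩
    exact h1.congr fun q hq => hfun_pos hq.1 q.2
  · obtain ⟨C, hC⟩ := hφg
    refine ⟨|C|, abs_nonneg _, fun w x => ?_⟩
    by_cases hw : w ∈ Set.Ioo 0 T
    · rw [hfun_pos hw]
      refine le_of_tendsto (tend0 hφc j hw (exp_pos x)).abs ?_
      filter_upwards [Ioo_mem_nhdsGT hw.1] with y hy
      refine (hC w (exp x) y ⟨hw.1, hw.2, exp_pos x, hy.1, hy.2⟩ j).trans ?_
      exact mul_le_mul_of_nonneg_right (le_abs_self C) (by positivity)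
    · rw [hfun, if_neg hw, abs_zero]; positivity

/-- averaged trace -/
noncomputable def gfun {k : ℕ} (T : ℝ) (p : Fin k → Fin k → ℝ) (φ : ℝ → ℝ → Fin k → ℝ → ℝ) (i : Fin k)
    (w ξ : ℝ) : ℝ := ∑ j, p i j * hfun T φ j w ξ

/-- the weight -/
noncomputable def wt (r : ℝ) (fe : ℝ → ℝ) (y v : ℝ) : ℝ := exp (-r * v) * fe (y + v)

lemma wt_cont {r : ℝ} {fe : ℝ → ℝ} (h : Continuous fe) : Continuous (uncurry (wt r fe)) := by
  unfold uncurry wt; fun_prop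

lemma rhs_eq {k : ℕ} {r σ : Fin k → ℝ} {p : Fin k → Fin k → ℝ} {f F : Fin k → ℝ → ℝ} {K T : ℝ}
    {φ : ℝ → ℝ → Fin k → ℝ → ℝ} (hσ : ∀ i, 0 < σ i) (hh : ∀ j, GC T (hfun T φ j)) (i : Fin k)
    {fe : ℝ → ℝ} (hfc : Continuous fe) (hfe : ∀ y, 0 ≤ y → fe y = f i y) {t s y : ℝ}
    (hq : (t, s, y) ∈ domD T) :
    ieRHS r σ p f F K T φ t s i y =
      (1 - F i (T - t + y)) / (1 - F i y) * bsPrice (r i) (σ i) K T t s +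
      1 / (1 - F i y) * J (r i - σ i ^ 2 / 2) (σ i) T (fun y v _ => wt (r i) fe y v) (gfun T p φ i) t (log s) y := by
  obtain ⟨ht, htT, hs, hy, hyt⟩ := hq
  simp only at ht htT hs hy hyt
  have hg : GC T (gfun T p φ i) := GC.sum hh (p i)
  rw [ieRHS, J_eq (hσ i).le hg (AC_one (wt_cont hfc))]
  congr 1
  have hsub : Set.Ioo 0 (T - t) ⊆ Set.Ioo 0 T := Set.Ioo_subset_Ioo_right (by linarith)
  rw [setIntegral_eq_of_subset_of_forall_sdiff_eq_zero measurableSet_Ioo hsub, ← integral_const_mul]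
  · refine setIntegral_congr_fun measurableSet_Ioo fun v hv => ?_
    have hw : t + v ∈ Set.Ioo 0 T := ⟨by linarith [hv.1], by linarith [hv.2]⟩
    rw [integral_const_mul, wt, hfe (y + v) (by linarith [hv.1])]
    have e1 : ∫ z, gfun T p φ i (t + v) (log s + (r i - σ i ^ 2 / 2) * v + σ i * √v * z) ∂gam =
        ∑ j, p i j * ∫ x in Set.Ioi (0 : ℝ), φ (t + v) x j 0 * lnKernel (r i) (σ i) x s v := by
      simp only [gfun]
      rw [integral_finsetSum]
      · refine Finset.sum_congr rfl fun j _ => ?_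
        rw [integral_const_mul, chvar (hσ i) hs hv.1 (fun x => φ (t + v) x j 0)]
        congr 1
        refine integral_congr_ae (ae_of_all _ fun z => ?_)
        simp only [hfun_pos hw]
      · intro j _
        refine Integrable.const_mul ?_ _
        have := slice_int (m := r i - σ i ^ 2 / 2) (hσ i).le (hh j) (AC_one (T := T) (b := fun _ _ => 1) (by fun_prop)) 0 (log s) (t + v) v (hsub hv)
        simpa using this
    rw [e1]
    ring
  · intro v hv
    have hw : t + v ∉ Set.Ioo 0 T := fun h => hv.2 ⟨hv.1.1, by linarith [h.2]⟩
    simp [hg.zero _ hw]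

lemma h_eq {k : ℕ} {r σ : Fin k → ℝ} {p : Fin k → Fin k → ℝ} {f F : Fin k → ℝ → ℝ} {K T : ℝ}
    {φ : ℝ → ℝ → Fin k → ℝ → ℝ} (hσ : ∀ i, 0 < σ i) (hh : ∀ j, GC T (hfun T φ j))
    (hφc : ContOnClosure T φ) (hφIE : SolvesIE r σ p f F K T φ) (i : Fin k)
    {fe Fe : ℝ → ℝ} (hfc : Continuous fe) (hfe : ∀ y, 0 ≤ y → fe y = f i y)
    (hFc : Continuous Fe) (hF0 : Fe 0 = 0) (hFe : ∀ y, 0 ≤ y → Fe y = F i y) {w : ℝ} (hw : w ∈ Set.Ioo 0 T) (ξ : ℝ) :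
    hfun T φ i w ξ = (1 - Fe (T - w)) * bsPrice (r i) (σ i) K T w (exp ξ) +
      J (r i - σ i ^ 2 / 2) (σ i) T (fun y v _ => wt (r i) fe y v) (gfun T p φ i) w ξ 0 := by
  rw [hfun_pos hw]
  have hg : GC T (gfun T p φ i) := GC.sum hh (p i)
  refine tendsto_nhds_unique (tend0 hφc i hw (exp_pos ξ)) ?_
  have hJ := J_cont (m := r i - σ i ^ 2 / 2) (hσ i).le hg (AC_one (T := T) (wt_cont (r := r i) hfc))
  have hJ2 : Continuous (fun y => J (r i - σ i ^ 2 / 2) (σ i) T (fun y v _ => wt (r i) fe y v) (gfun T p φ i) w ξ y) :=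
    hJ.comp (f := fun y : ℝ => (w, ξ, y)) (by fun_prop)
  have hc : ContinuousAt (fun y => (1 - Fe (T - w + y)) / (1 - Fe y) * bsPrice (r i) (σ i) K T w (exp ξ) +
      1 / (1 - Fe y) * J (r i - σ i ^ 2 / 2) (σ i) T (fun y v _ => wt (r i) fe y v) (gfun T p φ i) w ξ y) 0 := by
    have n : 1 - Fe 0 ≠ 0 := by rw [hF0]; norm_num
    refine ContinuousAt.add (ContinuousAt.mul (ContinuousAt.div (by fun_prop) (by fun_prop) n) continuousAt_const)
      (ContinuousAt.mul (ContinuousAt.div continuousAt_const (by fun_prop) n) hJ2.continuousAt)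
  have ht := hc.tendsto.mono_left (nhdsWithin_le_nhds (s := Set.Ioi 0))
  simp only [hF0, sub_zero, add_zero, div_one, one_mul] at ht
  refine ht.congr' ?_
  filter_upwards [Ioo_mem_nhdsGT hw.1] with y hy
  have hq : (w, exp ξ, y) ∈ domD T := ⟨hw.1, hw.2, exp_pos ξ, hy.1, hy.2⟩
  rw [hφIE.1 _ _ _ hq i, rhs_eq hσ hh i hfc hfe hq, log_exp, hFe y hy.1.le,
    hFe (T - w + y) (by linarith [hw.2, hy.1])]

/-- the logarithmic derivative of the trace -/
lemma h_deriv {k : ℕ} {r σ : Fin k → ℝ} {p : Fin k → Fin k → ℝ} {f F : Fin k → ℝ → ℝ} {K T : ℝ}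
    {φ : ℝ → ℝ → Fin k → ℝ → ℝ} (hK : 0 < K) (hσ : ∀ i, 0 < σ i) (hh : ∀ j, GC T (hfun T φ j))
    (hφc : ContOnClosure T φ) (hφIE : SolvesIE r σ p f F K T φ) (i : Fin k)
    {fe Fe : ℝ → ℝ} (hfc : Continuous fe) (hfe : ∀ y, 0 ≤ y → fe y = f i y)
    (hFc : Continuous Fe) (hF0 : Fe 0 = 0) (hFe : ∀ y, 0 ≤ y → Fe y = F i y) :
    ∃ h' : ℝ → ℝ → ℝ, GC T h' ∧ ∀ w ξ, HasDerivAt (hfun T φ i w) (h' w ξ) ξ := by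
  classical
  have hg : GC T (gfun T p φ i) := GC.sum hh (p i)
  have A1 : AC T (fun y v _ => wt (r i) fe y v) := AC_one (T := T) (wt_cont (r := r i) hfc)
  have A2 := AC_ker (T := T) (hσ i) (wt_cont (r := r i) hfc)
  set D : ℝ → ℝ → ℝ := fun w ξ => (1 - Fe (T - w)) * bsD (r i) (σ i) K T w ξ +
    J (r i - σ i ^ 2 / 2) (σ i) T (fun y v z => wt (r i) fe y v * (z / (σ i * √v))) (gfun T p φ i) w ξ 0 with hD
  refine ⟨fun w ξ => if w ∈ Set.Ioo 0 T then D w ξ else 0, ⟨?_, fun w hw x => if_neg hw, ?_⟩, ?_⟩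
  · have h1 : ContinuousOn (fun q : ℝ × ℝ => D q.1 q.2) (Set.Ioo 0 T ×ˢ Set.univ) := by
      refine ContinuousOn.add (ContinuousOn.mul (by fun_prop) (bsD_cont (hσ i))) ?_
      have := (J_cont (m := r i - σ i ^ 2 / 2) (hσ i).le hg A2).comp
        (f := fun q : ℝ × ℝ => (q.1, q.2, (0:ℝ))) (by fun_prop)
      exact this.continuousOn
    exact h1.congr fun q hq => if_pos hq.1
  · obtain ⟨N, hN, hNb⟩ := bsD_bound
    obtain ⟨B, hB, hBb⟩ := J_bound (m := r i - σ i ^ 2 / 2) (hσ i).le hg A2 0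
    have hcF : ContinuousOn (fun w => 1 - Fe (T - w)) (Set.Icc 0 T) := by fun_prop
    obtain ⟨M, hM⟩ := isCompact_Icc.exists_bound_of_continuousOn hcF
    refine ⟨|M| * N + B, by positivity, fun w x => ?_⟩
    split_ifs with hw
    · have e1 := (hM w ⟨hw.1.le, hw.2.le⟩).trans (le_abs_self M)
      rw [Real.norm_eq_abs] at e1
      have e2 := hNb (r i) (σ i) K T w x
      have e3 := hBb w x
      refine (abs_add_le _ _).trans ?_
      rw [abs_mul]
      have e4 := mul_le_mul e1 e2 (abs_nonneg _) (abs_nonneg _)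
      linarith
    · rw [abs_zero]; positivity
  · intro w ξ
    by_cases hw : w ∈ Set.Ioo 0 T
    · simp only [if_pos hw]
      have e : hfun T φ i w = fun ξ => (1 - Fe (T - w)) * bsPrice (r i) (σ i) K T w (exp ξ) +
          J (r i - σ i ^ 2 / 2) (σ i) T (fun y v _ => wt (r i) fe y v) (gfun T p φ i) w ξ 0 :=
        funext fun ξ => h_eq hσ hh hφc hφIE i hfc hfe hFc hF0 hFe hw ξ
      rw [e]
      exact ((bs_deriv (hσ i) hK hw.2 ξ).const_mul _).add (J_dx_kernel (hσ i) hg A1 A2 w ξ 0)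
    · simp only [if_neg hw]
      have e : hfun T φ i w = fun _ => 0 := funext fun ξ => by rw [hfun, if_neg hw]
      rw [e]; exact hasDerivAt_const _ _

/-- main regularity result for a fixed regime -/
lemma main_i {k : ℕ} {T K : ℝ} (hK : 0 < K) {r σ : Fin k → ℝ} (hσ : ∀ i, 0 < σ i)
    {p : Fin k → Fin k → ℝ} {f : Fin k → ℝ → ℝ} (hfC1 : ∀ i, ContDiffOn ℝ 1 (f i) (Set.Ici 0))
    {F : Fin k → ℝ → ℝ} (hFdef : ∀ i y, F i y = ∫ u in (0 : ℝ)..y, f i u)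
    (hFlt : ∀ i y, 0 ≤ y → F i y < 1)
    {φ : ℝ → ℝ → Fin k → ℝ → ℝ}
    (hφc : ContOnClosure T φ) (hφg : LinGrowth T φ) (hφIE : SolvesIE r σ p f F K T φ) (i : Fin k) :
    C121 (domD T) (fun t s y => φ t s i y) := by
  choose fe fe' hfc' hfd hfe using fun i => ext_C1 (hfC1 i)
  have hfc : ∀ i, Continuous (fe i) := fun i => continuous_iff_continuousAt.2 fun v => (hfd i v).continuousAt
  have hf1 : ∀ i, ContDiff ℝ 1 (fe i) := by
    intro i
    rw [contDiff_one_iff_deriv]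
    refine ⟨fun x => (hfd i x).differentiableAt, ?_⟩
    have : deriv (fe i) = fe' i := funext fun x => (hfd i x).deriv
    rw [this]; exact hfc' i
  set Fe : Fin k → ℝ → ℝ := fun i y => ∫ u in (0:ℝ)..y, fe i u with hFe0
  have hFd : ∀ i y, HasDerivAt (Fe i) (fe i y) y := fun i y =>
    ((hfc i).integral_hasStrictDerivAt 0 y).hasDerivAt
  have hF2 : ∀ i, ContDiff ℝ 2 (Fe i) := by
    intro i
    have : (2 : WithTop ℕ∞) = 1 + 1 := by norm_num
    rw [this, contDiff_succ_iff_deriv]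
    refine ⟨fun x => (hFd i x).differentiableAt, by simp, ?_⟩
    have : deriv (Fe i) = fe i := funext fun x => (hFd i x).deriv
    rw [this]; exact hf1 i
  have hFe : ∀ i y, 0 ≤ y → Fe i y = F i y := by
    intro i y hy
    rw [hFdef]
    refine intervalIntegral.integral_congr fun u hu => ?_
    rw [Set.uIcc_of_le hy] at hu
    exact hfe i u hu.1
  have hF00 : ∀ i, Fe i 0 = 0 := fun i => by simp [hFe0]
  have hh : ∀ j, GC T (hfun T φ j) := hfun_GC hφc hφg
  choose h' hGC' hder using fun j =>
    h_deriv hK hσ hh hφc hφIE j (hfc j) (hfe j) (hF2 j).continuous (hF00 j) (hFe j)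
  have hg : GC T (gfun T p φ i) := GC.sum hh (p i)
  have hg' : GC T (fun w x => ∑ j, p i j * h' j w x) := GC.sum hGC' (p i)
  have hgd : ∀ w x, HasDerivAt (gfun T p φ i w) (∑ j, p i j * h' j w x) x := by
    intro w x
    have := HasDerivAt.fun_sum (u := Finset.univ) (A := fun j x => p i j * hfun T φ j w x)
      (A' := fun j => p i j * h' j w x) (x := x) (fun j _ => (hder j w x).const_mul _)
    exact this
  have hW := C121_W (r := r i) (m := r i - σ i ^ 2 / 2) (hσ i) (hfc' i) (hfd i) hg hg' hgd
  have hbs : C121 (domD T) (fun t s _ => bsPrice (r i) (σ i) K T t s) :=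
    C121_of_contDiffOn (isOpen_domD T) (bs_contDiffOn (hσ i) hK)
  have hne : ∀ q ∈ domD T, 1 - Fe i q.2.2 ≠ 0 := by
    intro q hq
    have := hFlt i q.2.2 hq.2.2.2.1.le
    rw [hFe i _ hq.2.2.2.1.le]; linarith
  have cy : ContDiff ℝ 2 (fun q : ℝ × ℝ × ℝ => 1 - Fe i q.2.2) :=
    contDiff_const.sub ((hF2 i).comp (by fun_prop))
  have cty : ContDiff ℝ 2 (fun q : ℝ × ℝ × ℝ => 1 - Fe i (T - q.1 + q.2.2)) :=
    contDiff_const.sub ((hF2 i).comp (by fun_prop))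
  have hP : C121 (domD T) (fun t _ y => (1 - Fe i (T - t + y)) / (1 - Fe i y)) :=
    C121_of_contDiffOn (isOpen_domD T) (cty.contDiffOn.div cy.contDiffOn hne)
  have hR : C121 (domD T) (fun _ _ y => 1 / (1 - Fe i y)) :=
    C121_of_contDiffOn (isOpen_domD T) (contDiffOn_const.div cy.contDiffOn hne)
  refine ((hP.mul hbs).add (hR.mul hW)).congr (isOpen_domD T) fun t s y hq => ?_
  have hy : 0 < y := hq.2.2.2.1
  have htT : t < T := hq.2.1
  rw [hφIE.1 _ _ _ hq i, rhs_eq hσ hh i (hfc i) (hfe i) hq, hFe i y hy.le,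
    hFe i (T - t + y) (by linarith)]
  rfl
end VR

/-- The unique non-negative continuous linear-growth solution of the Volterra
integral equation is of class `C^{1,2,1}` on `D`. -/
theorem volterra_solution_regularity
    (k : ℕ) (hk : 1 ≤ k) (T K : ℝ) (hT : 0 < T) (hK : 0 < K)
    (r σ : Fin k → ℝ) (hr : ∀ i, 0 ≤ r i) (hσ : ∀ i, 0 < σ i)
    (p : Fin k → Fin k → ℝ) (hp0 : ∀ i j, 0 ≤ p i j)
    (hp1 : ∀ i, ∑ j, p i j = 1) (hpd : ∀ i, p i i = 0)
    (f : Fin k → ℝ → ℝ)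
    (hfC1 : ∀ i, ContDiffOn ℝ 1 (f i) (Set.Ici 0))
    (hfbd : ∀ i, ∃ M : ℝ, ∀ y, 0 ≤ y → f i y ≤ M)
    (hfpos : ∀ i y, 0 < y → 0 < f i y)
    (hfnn : ∀ i y, 0 ≤ y → 0 ≤ f i y)
    (hfdens : ∀ i, ∫ u in Set.Ioi (0 : ℝ), f i u = 1)
    (F : Fin k → ℝ → ℝ) (hFdef : ∀ i y, F i y = ∫ u in (0 : ℝ)..y, f i u)
    (hFlt : ∀ i y, 0 ≤ y → F i y < 1)
    (φ : ℝ → ℝ → Fin k → ℝ → ℝ)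
    (hφc : ContOnClosure T φ) (hφg : LinGrowth T φ)
    (hφnn : ∀ t s y : ℝ, (t, s, y) ∈ domDbar T → ∀ i, 0 ≤ φ t s i y)
    (hφIE : SolvesIE r σ p f F K T φ) :
    ∃ Dt Ds Dss Dy : ℝ → ℝ → Fin k → ℝ → ℝ,
      (∀ t s y : ℝ, (t, s, y) ∈ domD T → ∀ i,
        HasDerivAt (fun τ => φ τ s i y) (Dt t s i y) t ∧
        HasDerivAt (fun w => φ t w i y) (Ds t s i y) s ∧
        HasDerivAt (fun w => Ds t w i y) (Dss t s i y) s ∧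
        HasDerivAt (fun u => φ t s i u) (Dy t s i y) y) ∧
      (∀ i, ContinuousOn (fun q : ℝ × ℝ × ℝ => Dt q.1 q.2.1 i q.2.2) (domD T) ∧
            ContinuousOn (fun q : ℝ × ℝ × ℝ => Ds q.1 q.2.1 i q.2.2) (domD T) ∧
            ContinuousOn (fun q : ℝ × ℝ × ℝ => Dss q.1 q.2.1 i q.2.2) (domD T) ∧
            ContinuousOn (fun q : ℝ × ℝ × ℝ => Dy q.1 q.2.1 i q.2.2) (domD T)) := by
  choose _hc Dt Ds Dss Dy h1 h2 using fun i => VR.main_i hK hσ hfC1 hFdef hFlt hφc hφg hφIE i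
  exact ⟨fun t s i y => Dt i t s y, fun t s i y => Ds i t s y, fun t s i y => Dss i t s y,
    fun t s i y => Dy i t s y, fun t s y hq i => h1 i t s y hq, fun i => h2 i⟩
end
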